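/- arXiv:1804.05952 — 2 statements merged into one kernel-verified Lean document; each statement's English description precedes it below -/
import Mathlib

section
/- For all integers m, k ≥ 3, we have ESO(m,k) ≤ (m−1)(k−1). Equivalently, player A has a strategy in the game A_{m,k} guaranteeing that, for every strategy of player B, among the first (m−1)(k−1) points played there is an m-up-run or a k-down-run. -/
open Set

/-- A point in the plane. -/
abbrev Pt : Type := ℝ × ℝ

/-- The point set `P` contains an `n`-up-run: `n` points with strictly increasing
`x`-coordinates and nondecreasing `y`-coordinates. -/
def HasUpRun (P : Set Pt) (n : ℕ) : Prop :=
  ∃ f : Fin n → Pt, (∀ i, f i ∈ P) ∧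
    StrictMono (fun i => (f i).1) ∧ Monotone (fun i => (f i).2)

/-- The point set `P` contains an `n`-down-run: `n` points with strictly increasing
`x`-coordinates and strictly decreasing `y`-coordinates. -/
def HasDownRun (P : Set Pt) (n : ℕ) : Prop :=
  ∃ f : Fin n → Pt, (∀ i, f i ∈ P) ∧
    StrictMono (fun i => (f i).1) ∧ StrictAnti (fun i => (f i).2)

/-- A strategy for player A: from the list of previously played points, choose
an x-coordinate. -/
abbrev AStrat : Type := List Pt → ℝ

/-- A strategy for player B: from the list of previously played points and the new
x-coordinate, choose a y-coordinate. -/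
abbrev BStrat : Type := List Pt → ℝ → ℝ

/-- Validity of a strategy for player A in either game: the chosen x-coordinate lies in
`(0,1)` and is distinct from all previously played x-coordinates. -/
def AValid (sA : AStrat) : Prop :=
  ∀ h : List Pt, sA h ∈ Ioo (0:ℝ) 1 ∧ ∀ p ∈ h, sA h ≠ p.1

/-- Validity of a strategy for player B in the game `A_{m,k}`: the chosen y-coordinate
lies in `(0,1)` and is distinct from all previously played y-coordinates. -/
def BValid (sB : BStrat) : Prop :=
  ∀ (h : List Pt) (x : ℝ), sB h x ∈ Ioo (0:ℝ) 1 ∧ ∀ p ∈ h, sB h x ≠ p.2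

/-- The list of points played in the first `n` turns when A plays `sA` and B plays `sB`. -/
def hist (sA : AStrat) (sB : BStrat) : ℕ → List Pt
  | 0 => []
  | n + 1 =>
      let h := hist sA sB n
      h ++ [(sA h, sB h (sA h))]

/-- The set of points played in the first `N` turns. -/
def played (sA : AStrat) (sB : BStrat) (N : ℕ) : Set Pt :=
  {p | p ∈ hist sA sB N}

/-- In the game `A_{m,k}`, strategy `sA` of player A is valid and guarantees an
`m`-up-run or a `k`-down-run among the first `N` points, against every valid
strategy of player B. -/
def AWinsBy (m k N : ℕ) (sA : AStrat) : Prop :=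
  AValid sA ∧ ∀ sB : BStrat, BValid sB →
    HasUpRun (played sA sB N) m ∨ HasDownRun (played sA sB N) k

/-- The Erdős–Szekeres on-line number `ESO(m,k)`: the least `N` such that player A
has a strategy forcing an `m`-up-run or a `k`-down-run within `N` turns. -/
noncomputable def ESO (m k : ℕ) : ℕ := sInf {N | ∃ sA : AStrat, AWinsBy m k N sA}

/-- Validity of a strategy for player B in the tier game `B_{m,k}`: the chosen
y-coordinate is an integer in `{1, …, k-1}` (repetitions allowed). -/
def BTierValid (k : ℕ) (sB : BStrat) : Prop :=
  ∀ (h : List Pt) (x : ℝ), ∃ j : ℕ, 1 ≤ j ∧ j ≤ k - 1 ∧ sB h x = (j : ℝ)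

/-- In the tier game `B_{m,k}`, strategy `sA` of player A is valid and guarantees an
`m`-up-run among the first `N` points, against every valid strategy of player B. -/
def AWinsTierBy (m k N : ℕ) (sA : AStrat) : Prop :=
  AValid sA ∧ ∀ sB : BStrat, BTierValid k sB → HasUpRun (played sA sB N) m

/-- `B(m,k)`: the least `N` such that player A has a strategy forcing an `m`-up-run
within `N` turns of the tier game `B_{m,k}`. -/
noncomputable def BNum (m k : ℕ) : ℕ := sInf {N | ∃ sA : AStrat, AWinsTierBy m k N sA}

/-- `RelChain r l x y`: there is an `r`-chain with `l` steps from `x` to `y`. -/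
def RelChain {α : Type*} (r : α → α → Prop) : ℕ → α → α → Prop
  | 0, x, y => x = y
  | l + 1, x, y => ∃ z, RelChain r l x z ∧ r z y

namespace RelChain

variable {α β : Type*} {r : α → α → Prop}

theorem cons {l : ℕ} {x y z : α} (hxy : r x y) (h : RelChain r l y z) :
    RelChain r (l + 1) x z := by
  induction l generalizing z with
  | zero => exact ⟨x, rfl, h ▸ hxy⟩
  | succ l ih =>
    obtain ⟨w, hw, hwz⟩ := h
    exact ⟨w, ih hw, hwz⟩

theorem of_flip {l : ℕ} {x y : α} (h : RelChain (flip r) l x y) : RelChain r l y x := by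
  induction l generalizing y with
  | zero => exact Eq.symm h
  | succ l ih =>
    obtain ⟨w, hw, hwy⟩ := h
    exact cons hwy (ih hw)

theorem map {r' : β → β → Prop} (g : α → β) (hg : ∀ x y, r x y → r' (g x) (g y)) {l : ℕ}
    {x y : α} (h : RelChain r l x y) : RelChain r' l (g x) (g y) := by
  induction l generalizing y with
  | zero => exact congrArg g h
  | succ l ih =>
    obtain ⟨w, hw, hwy⟩ := h
    exact ⟨g w, ih hw, hg _ _ hwy⟩

theorem bounded [Preorder α] (hlt : ∀ x y, r x y → x < y) {l : ℕ} {x y t : α}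
    (h : RelChain r l x y) (hy : y ≤ t) : RelChain (fun i j => r i j ∧ j ≤ t) l x y := by
  induction l generalizing y with
  | zero => exact h
  | succ l ih =>
    obtain ⟨w, hw, hwy⟩ := h
    exact ⟨w, ih hw ((hlt _ _ hwy).le.trans hy), hwy, hy⟩

theorem exists_fin {l : ℕ} {x y : α} (h : RelChain r l x y) :
    ∃ f : Fin (l + 1) → α, f (Fin.last l) = y ∧ ∀ i : Fin l, r (f i.castSucc) (f i.succ) := by
  induction l generalizing y with
  | zero => exact ⟨fun _ => y, rfl, fun i => i.elim0⟩
  | succ l ih =>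
    obtain ⟨w, hw, hwy⟩ := h
    obtain ⟨f, hf, hstep⟩ := ih hw
    refine ⟨Fin.snoc f y, by simp, fun i => ?_⟩
    induction i using Fin.lastCases with
    | last => simpa [hf] using hwy
    | cast i =>
      rw [Fin.succ_castSucc, Fin.snoc_castSucc, Fin.snoc_castSucc]
      exact hstep i

end RelChain

/-- The largest `l ≤ n` such that some `r`-chain with `l` steps ends at `x`. -/
noncomputable def chainRank {α : Type*} (r : α → α → Prop) (n : ℕ) (x : α) : ℕ :=
  open Classical in Nat.findGreatest (fun l => ∃ w, RelChain r l w x) n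

section Rank

variable {α : Type*} {r s : α → α → Prop} {a b : ℕ}

theorem exists_relChain_chainRank (r : α → α → Prop) (n : ℕ) (x : α) :
    ∃ w, RelChain r (chainRank r n x) w x := by
  classical
  exact Nat.findGreatest_spec (P := fun l => ∃ w, RelChain r l w x) (Nat.zero_le n) ⟨x, rfl⟩

theorem chainRank_lt (hr : ∀ x y, ¬ RelChain r a x y) (x : α) : chainRank r a x < a := by
  classical
  refine lt_of_le_of_ne (Nat.findGreatest_le a) fun h => ?_
  obtain ⟨w, hw⟩ := exists_relChain_chainRank r a x
  exact hr w x (h ▸ hw)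

theorem chainRank_lt_chainRank (hr : ∀ x y, ¬ RelChain r a x y) {x y : α} (hxy : r x y) :
    chainRank r a x < chainRank r a y := by
  classical
  obtain ⟨w, hw⟩ := exists_relChain_chainRank r a x
  exact Nat.le_findGreatest (P := fun l => ∃ w, RelChain r l w y)
    (chainRank_lt hr x) ⟨w, x, hw, hxy⟩

theorem le_chainRank (hr : ∀ x y, ¬ RelChain r a x y) {l : ℕ} {w x : α}
    (h : RelChain r l w x) : l ≤ chainRank r a x := by
  induction l generalizing x with
  | zero => exact Nat.zero_le _
  | succ l ih =>
    obtain ⟨z, hz, hzx⟩ := h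
    exact (ih hz).trans_lt (chainRank_lt_chainRank hr hzx)

theorem exists_chainRank_eq [Fintype α] (hcard : Fintype.card α = a * b)
    (hr : ∀ x y, ¬ RelChain r a x y) (hs : ∀ x y, ¬ RelChain s b x y)
    (htri : ∀ x y, x ≠ y → r x y ∨ r y x ∨ s x y ∨ s y x) {i j : ℕ} (hi : i < a) (hj : j < b) :
    ∃ x, chainRank r a x = i ∧ chainRank s b x = j := by
  let F : α → Fin a × Fin b := fun x =>
    (⟨chainRank r a x, chainRank_lt hr x⟩, ⟨chainRank s b x, chainRank_lt hs x⟩)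
  have hinj : Function.Injective F := by
    intro x y hxy
    have h1 : chainRank r a x = chainRank r a y := congrArg (fun p => (p.1 : ℕ)) hxy
    have h2 : chainRank s b x = chainRank s b y := congrArg (fun p => (p.2 : ℕ)) hxy
    by_contra hne
    rcases htri x y hne with h | h | h | h
    · exact (chainRank_lt_chainRank hr h).ne h1
    · exact (chainRank_lt_chainRank hr h).ne h1.symm
    · exact (chainRank_lt_chainRank hs h).ne h2
    · exact (chainRank_lt_chainRank hs h).ne h2.symm
  have hsurj := ((Fintype.bijective_iff_injective_and_card F).2 ⟨hinj, by simp [hcard]⟩).2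
  obtain ⟨x, hx⟩ := hsurj (⟨i, hi⟩, ⟨j, hj⟩)
  exact ⟨x, congrArg (fun p => (p.1 : ℕ)) hx, congrArg (fun p => (p.2 : ℕ)) hx⟩

end Rank

/-- Two transitive relations that partition the strict order relation of a linear order. -/
structure SplitsLT {α : Type*} [LinearOrder α] (r s : α → α → Prop) : Prop where
  left_lt : ∀ x y, r x y → x < y
  right_lt : ∀ x y, s x y → x < y
  total : ∀ x y, x < y → r x y ∨ s x y
  disjoint : ∀ x y, r x y → ¬ s x y
  left_trans : ∀ x y z, r x y → r y z → r x z
  right_trans : ∀ x y z, s x y → s y z → s x z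

namespace SplitsLT

variable {α : Type*} [LinearOrder α] {r s : α → α → Prop} {a b : ℕ}

theorem symm (h : SplitsLT r s) : SplitsLT s r :=
  ⟨h.right_lt, h.left_lt, fun x y hxy => (h.total x y hxy).symm,
    fun x y hs hr => h.disjoint x y hr hs, h.right_trans, h.left_trans⟩

theorem trichotomy (h : SplitsLT r s) (x y : α) (hne : x ≠ y) :
    r x y ∨ r y x ∨ s x y ∨ s y x := by
  rcases lt_or_gt_of_ne hne with hlt | hlt <;> have := h.total _ _ hlt <;> tauto

/-- Within a rank class, the set of endpoints of chains of maximal length from the least element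
is closed downwards. -/
theorem relChain_of_le (h : SplitsLT r s) (hr : ∀ x y, ¬ RelChain r a x y) {p : α}
    (hp : ∀ x, p ≤ x) {l : ℕ} {x y : α} (hx : chainRank r a x = l) (hy : chainRank r a y = l)
    (hyx : y ≤ x) (hc : RelChain r l p x) : RelChain r l p y := by
  induction l generalizing x y with
  | zero =>
    have hpx : p = x := hc
    exact le_antisymm (hp y) (hpx ▸ hyx)
  | succ l ih =>
    obtain ⟨x', hpx', hx'⟩ := hc
    obtain ⟨w, hw⟩ := exists_relChain_chainRank r a y
    rw [hy] at hw
    obtain ⟨y', hwy', hy'⟩ := hw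
    have hxr : chainRank r a x' = l := by
      have h1 := le_chainRank hr hpx'
      have h2 := chainRank_lt_chainRank hr hx'
      omega
    have hyr : chainRank r a y' = l := by
      have h1 := le_chainRank hr hwy'
      have h2 := chainRank_lt_chainRank hr hy'
      omega
    rcases le_total y' x' with hle | hle
    · exact ⟨y', ih hxr hyr hle hpx', hy'⟩
    · refine ⟨x', hpx', (h.total _ _ (hle.trans_lt (h.left_lt _ _ hy'))).resolve_right fun hs => ?_⟩
      rcases hyx.eq_or_lt with rfl | hlt
      · exact h.disjoint _ _ hx' hs
      · rcases h.total _ _ hlt with hyx' | hyx'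
        · have := chainRank_lt_chainRank hr hyx'
          omega
        · exact h.disjoint _ _ hx' (h.right_trans _ _ _ hs hyx')

/-- In an extremal configuration, some longest `r`-chain starts at the least element and avoids
the greatest element. -/
theorem exists_relChain_ne [Fintype α] (h : SplitsLT r s) (hcard : Fintype.card α = (a + 1) * b)
    (hb : 2 ≤ b) (hr : ∀ x y, ¬ RelChain r (a + 1) x y) (hs : ∀ x y, ¬ RelChain s b x y)
    {p : α} (hp : ∀ x, p ≤ x) {q : α} (hq : ∀ x, x ≤ q) :
    ∃ t, t ≠ q ∧ RelChain r a p t := by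
  have hstart : ∃ t, RelChain r a p t := by
    obtain ⟨x, hx1, hx2⟩ := exists_chainRank_eq (r := flip r) (s := flip s) (j := b - 1) hcard
      (fun x y hc => hr _ _ hc.of_flip) (fun x y hc => hs _ _ hc.of_flip)
      (fun x y hne => by have := h.trichotomy x y hne; simp only [flip]; tauto)
      (Nat.lt_succ_self a) (by omega)
    obtain ⟨t, ht⟩ := exists_relChain_chainRank (flip r) (a + 1) x
    obtain ⟨t', ht'⟩ := exists_relChain_chainRank (flip s) b x
    rw [hx1] at ht
    rw [hx2] at ht'
    rcases (hp x).eq_or_lt with rfl | hlt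
    · exact ⟨t, ht.of_flip⟩
    · rcases h.total _ _ hlt with hpx | hpx
      · exact (hr _ _ (ht.of_flip.cons hpx)).elim
      · have hc := ht'.of_flip.cons hpx
        rw [Nat.sub_add_cancel (by omega)] at hc
        exact (hs _ _ hc).elim
  obtain ⟨t, ht⟩ := hstart
  by_cases htq : t = q
  · have hother : ∃ c, c ≠ q ∧ chainRank r (a + 1) c = a := by
      obtain ⟨c, hc, hc0⟩ := exists_chainRank_eq hcard hr hs h.trichotomy
        (Nat.lt_succ_self a) (show 0 < b by omega)
      obtain ⟨d, hd, hd1⟩ := exists_chainRank_eq hcard hr hs h.trichotomy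
        (Nat.lt_succ_self a) (show 1 < b by omega)
      by_cases hcq : c = q
      · refine ⟨d, fun hdq => ?_, hd⟩
        subst hcq hdq
        omega
      · exact ⟨c, hcq, hc⟩
    obtain ⟨c, hcq, hc⟩ := hother
    have htr : chainRank r (a + 1) t = a := by
      have h1 := le_chainRank hr ht
      have h2 := chainRank_lt hr t
      omega
    exact ⟨c, hcq, h.relChain_of_le hr hp htr hc (htq ▸ hq c) ht⟩
  · exact ⟨t, htq, ht⟩

end SplitsLT

/-- Both points lie in `P` and they form an up-run of length two. -/
def UpStep (P : Set Pt) (p q : Pt) : Prop := p ∈ P ∧ q ∈ P ∧ p.1 < q.1 ∧ p.2 ≤ q.2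

/-- Both points lie in `P` and they form a down-run of length two. -/
def DownStep (P : Set Pt) (p q : Pt) : Prop := p ∈ P ∧ q ∈ P ∧ p.1 < q.1 ∧ q.2 < p.2

theorem HasUpRun.of_relChain {P : Set Pt} {l : ℕ} {x y : Pt}
    (h : RelChain (UpStep P) (l + 1) x y) : HasUpRun P (l + 2) := by
  obtain ⟨f, -, hf⟩ := h.exists_fin
  refine ⟨f, fun i => ?_, Fin.strictMono_iff_lt_succ.2 fun i => (hf i).2.2.1,
    Fin.monotone_iff_le_succ.2 fun i => (hf i).2.2.2⟩
  induction i using Fin.cases with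
  | zero => exact (hf 0).1
  | succ i => exact (hf i).2.1

theorem HasDownRun.of_relChain {P : Set Pt} {l : ℕ} {x y : Pt}
    (h : RelChain (DownStep P) (l + 1) x y) : HasDownRun P (l + 2) := by
  obtain ⟨f, -, hf⟩ := h.exists_fin
  refine ⟨f, fun i => ?_, Fin.strictMono_iff_lt_succ.2 fun i => (hf i).2.2.1,
    Fin.strictAnti_iff_succ_lt.2 fun i => (hf i).2.2.2⟩
  induction i using Fin.cases with
  | zero => exact (hf 0).1
  | succ i => exact (hf i).2.1

theorem HasUpRun.mono {P Q : Set Pt} (hPQ : P ⊆ Q) {n : ℕ} (h : HasUpRun P n) : HasUpRun Q n := by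
  obtain ⟨f, hf, h'⟩ := h
  exact ⟨f, fun i => hPQ (hf i), h'⟩

theorem HasDownRun.mono {P Q : Set Pt} (hPQ : P ⊆ Q) {n : ℕ} (h : HasDownRun P n) :
    HasDownRun Q n := by
  obtain ⟨f, hf, h'⟩ := h
  exact ⟨f, fun i => hPQ (hf i), h'⟩

/-- Every point to the left of all points of `h` completes an `m`-up-run or a `k`-down-run. -/
def LeftWins (m k : ℕ) (h : List Pt) : Prop :=
  ∀ z : Pt, (∀ p ∈ h, z.1 < p.1) →
    HasUpRun (insert z {p | p ∈ h}) m ∨ HasDownRun (insert z {p | p ∈ h}) k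

/-- If the points in order of abscissa have an extremal pattern, then without the rightmost one a
new leftmost point completes a run. -/
theorem exists_run_of_strictMono {a b n : ℕ} (ha : 1 ≤ a) (hb : 1 ≤ b)
    (hn : n + 1 = (a + 1) * (b + 1)) (g : Fin (n + 1) → Pt) (hg : StrictMono fun i => (g i).1)
    (h : List Pt) (hh : ∀ i : Fin (n + 1), i < Fin.last n → g i ∈ h)
    (hup : ¬ HasUpRun (range g) (a + 2)) (hdown : ¬ HasDownRun (range g) (b + 2)) :
    LeftWins (a + 2) (b + 2) h := by
  intro z hz
  let r : Fin (n + 1) → Fin (n + 1) → Prop := fun i j => i < j ∧ (g i).2 ≤ (g j).2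
  let s : Fin (n + 1) → Fin (n + 1) → Prop := fun i j => i < j ∧ (g j).2 < (g i).2
  have hsplit : SplitsLT r s :=
    ⟨fun _ _ h => h.1, fun _ _ h => h.1,
      fun x y hxy => (le_or_gt (g x).2 (g y).2).imp (⟨hxy, ·⟩) (⟨hxy, ·⟩),
      fun _ _ h h' => h.2.not_gt h'.2,
      fun _ _ _ h h' => ⟨h.1.trans h'.1, h.2.trans h'.2⟩,
      fun _ _ _ h h' => ⟨h.1.trans h'.1, h'.2.trans h.2⟩⟩
  have hr : ∀ x y, ¬ RelChain r (a + 1) x y := fun x y hc =>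
    hup (HasUpRun.of_relChain (hc.map g fun i j hij =>
      ⟨mem_range_self i, mem_range_self j, hg hij.1, hij.2⟩))
  have hs : ∀ x y, ¬ RelChain s (b + 1) x y := fun x y hc =>
    hdown (HasDownRun.of_relChain (hc.map g fun i j hij =>
      ⟨mem_range_self i, mem_range_self j, hg hij.1, hij.2⟩))
  obtain ⟨t, htq, ht⟩ := hsplit.exists_relChain_ne (by simpa using hn) (by omega) hr hs
    Fin.zero_le Fin.le_last
  obtain ⟨t', htq', ht'⟩ := hsplit.symm.exists_relChain_ne (by simpa [mul_comm] using hn)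
    (by omega) hs hr Fin.zero_le Fin.le_last
  have hlt := Fin.lt_last_iff_ne_last.2 htq
  have hlt' := Fin.lt_last_iff_ne_last.2 htq'
  have h0 : g 0 ∈ h := hh 0 ((Fin.zero_le t).trans_lt hlt)
  rcases le_or_gt z.2 (g 0).2 with hle | hgt
  · refine Or.inl (HasUpRun.of_relChain (x := z) (y := g t) (RelChain.cons
      ⟨mem_insert _ _, mem_insert_of_mem _ h0, hz _ h0, hle⟩
      ((ht.bounded hsplit.left_lt le_rfl).map g fun i j hij => ?_)))
    have hj := hij.2.trans_lt hlt
    exact ⟨mem_insert_of_mem _ (hh i (hij.1.1.trans hj)), mem_insert_of_mem _ (hh j hj),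
      hg hij.1.1, hij.1.2⟩
  · refine Or.inr (HasDownRun.of_relChain (x := z) (y := g t') (RelChain.cons
      ⟨mem_insert _ _, mem_insert_of_mem _ h0, hz _ h0, hgt⟩
      ((ht'.bounded hsplit.right_lt le_rfl).map g fun i j hij => ?_)))
    have hj := hij.2.trans_lt hlt'
    exact ⟨mem_insert_of_mem _ (hh i (hij.1.1.trans hj)), mem_insert_of_mem _ (hh j hj),
      hg hij.1.1, hij.1.2⟩

theorem exists_mem_Ioo_right (h : List Pt) :
    ∃ x ∈ Ioo (0 : ℝ) 1, ∀ p ∈ h, (p.1 < 1 → p.1 < x) ∧ x ≠ p.1 := by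
  induction h with
  | nil => exact ⟨1 / 2, by norm_num, by simp⟩
  | cons p h ih =>
    obtain ⟨x, ⟨hx0, hx1⟩, hx⟩ := ih
    by_cases hp : p.1 < 1
    · have h1 := le_max_left x p.1
      have h2 := le_max_right x p.1
      have h3 := max_lt hx1 hp
      refine ⟨(max x p.1 + 1) / 2, ⟨by linarith, by linarith⟩, ?_⟩
      rintro q hq
      have key : q.1 < 1 → q.1 < (max x p.1 + 1) / 2 := fun hq1 => by
        rcases List.mem_cons.1 hq with rfl | hq
        · linarith
        · linarith [(hx q hq).1 hq1]
      refine ⟨key, fun heq => ?_⟩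
      have := key (by linarith)
      linarith
    · refine ⟨x, ⟨hx0, hx1⟩, fun q hq => ?_⟩
      rcases List.mem_cons.1 hq with rfl | hq
      · exact ⟨fun h => absurd h hp, fun heq => hp (heq ▸ hx1)⟩
      · exact hx q hq

theorem exists_mem_Ioo_left (h : List Pt) :
    ∃ x ∈ Ioo (0 : ℝ) 1, ∀ p ∈ h, (0 < p.1 → x < p.1) ∧ x ≠ p.1 := by
  obtain ⟨x, ⟨hx0, hx1⟩, hx⟩ := exists_mem_Ioo_right (h.map fun p => (1 - p.1, p.2))
  refine ⟨1 - x, ⟨by linarith, by linarith⟩, fun p hp => ?_⟩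
  have := hx _ (List.mem_map_of_mem hp)
  refine ⟨fun hp0 => ?_, fun heq => this.2 ?_⟩
  · linarith [this.1 (by simpa using hp0)]
  · simp only
    linarith

/-- Player A plays to the right of all points, until playing to the left wins at once. -/
noncomputable def sweepStrat (m k : ℕ) : AStrat := fun h =>
  open Classical in
  if LeftWins m k h then (exists_mem_Ioo_left h).choose else (exists_mem_Ioo_right h).choose

theorem sweepStrat_valid (m k : ℕ) : AValid (sweepStrat m k) := by
  intro h
  unfold sweepStrat
  split_ifs
  · have := (exists_mem_Ioo_left h).choose_spec
    exact ⟨this.1, fun p hp => (this.2 p hp).2⟩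
  · have := (exists_mem_Ioo_right h).choose_spec
    exact ⟨this.1, fun p hp => (this.2 p hp).2⟩

theorem sweepStrat_lt {m k : ℕ} {h : List Pt} (hw : LeftWins m k h) {p : Pt} (hp : p ∈ h)
    (hp0 : 0 < p.1) : sweepStrat m k h < p.1 := by
  rw [sweepStrat, if_pos hw]
  exact ((exists_mem_Ioo_left h).choose_spec.2 p hp).1 hp0

theorem lt_sweepStrat {m k : ℕ} {h : List Pt} (hw : ¬ LeftWins m k h) {p : Pt} (hp : p ∈ h)
    (hp1 : p.1 < 1) : p.1 < sweepStrat m k h := by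
  rw [sweepStrat, if_neg hw]
  exact ((exists_mem_Ioo_right h).choose_spec.2 p hp).1 hp1

theorem mem_hist_iff {sA : AStrat} {sB : BStrat} {n : ℕ} {p : Pt} :
    p ∈ hist sA sB n ↔
      ∃ i < n, (sA (hist sA sB i), sB (hist sA sB i) (sA (hist sA sB i))) = p := by
  induction n with
  | zero => simp [hist]
  | succ n ih =>
    simp only [hist, List.mem_append, ih, List.mem_singleton, Nat.lt_succ_iff_lt_or_eq, or_and_right,
      exists_or, exists_eq_left]
    rw [eq_comm (a := p)]

theorem AValid.fst_mem_Ioo {sA : AStrat} (hA : AValid sA) {sB : BStrat} {n : ℕ} {p : Pt}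
    (hp : p ∈ hist sA sB n) : p.1 ∈ Ioo (0 : ℝ) 1 := by
  obtain ⟨i, -, rfl⟩ := mem_hist_iff.1 hp
  exact (hA _).1

theorem sweepStrat_wins {a b : ℕ} (ha : 1 ≤ a) (hb : 1 ≤ b) :
    AWinsBy (a + 2) (b + 2) ((a + 1) * (b + 1)) (sweepStrat (a + 2) (b + 2)) := by
  refine ⟨sweepStrat_valid _ _, fun sB _ => ?_⟩
  by_contra hno
  obtain ⟨n, hn⟩ : ∃ n, n + 1 = (a + 1) * (b + 1) :=
    ⟨(a + 1) * (b + 1) - 1, Nat.sub_add_cancel (Nat.mul_pos a.succ_pos b.succ_pos)⟩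
  rw [← hn] at hno
  set sA := sweepStrat (a + 2) (b + 2) with hsA
  have hA : AValid sA := sweepStrat_valid _ _
  let g : ℕ → Pt := fun i => (sA (hist sA sB i), sB (hist sA sB i) (sA (hist sA sB i)))
  have hmem : ∀ {i j : ℕ}, i < j → g i ∈ hist sA sB j := fun {i j} hij =>
    mem_hist_iff.2 ⟨i, hij, rfl⟩
  have hnot : ∀ i < n + 1, ¬ LeftWins (a + 2) (b + 2) (hist sA sB i) := by
    intro i hi hw
    have hsub : insert (g i) {p | p ∈ hist sA sB i} ⊆ played sA sB (n + 1) := by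
      rintro p (rfl | hp)
      · exact hmem hi
      · obtain ⟨j, hj, rfl⟩ := mem_hist_iff.1 hp
        exact hmem (hj.trans hi)
    exact hno ((hw (g i) fun p hp => sweepStrat_lt hw hp (hA.fst_mem_Ioo hp).1).imp
      (HasUpRun.mono hsub) (HasDownRun.mono hsub))
  have hrange : range (fun i : Fin (n + 1) => g i) ⊆ played sA sB (n + 1) := by
    rintro _ ⟨i, rfl⟩
    exact hmem i.2
  refine hnot n n.lt_succ_self (exists_run_of_strictMono ha hb hn (fun i => g i) ?_ _
    (fun i hi => hmem hi) (fun h => hno (Or.inl (h.mono hrange)))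
    (fun h => hno (Or.inr (h.mono hrange))))
  intro i j hij
  exact lt_sweepStrat (hnot j j.2) (hmem hij) (hA _).1.2

theorem ESO_le_of_three_le (m k : ℕ) (hm : 3 ≤ m) (hk : 3 ≤ k) :
    ESO m k ≤ (m - 1) * (k - 1) ∧
    ∃ sA : AStrat, AWinsBy m k ((m - 1) * (k - 1)) sA := by
  obtain ⟨a, rfl⟩ := Nat.exists_eq_add_of_le' (show 2 ≤ m by omega)
  obtain ⟨b, rfl⟩ := Nat.exists_eq_add_of_le' (show 2 ≤ k by omega)
  have h : ∃ sA : AStrat, AWinsBy (a + 2) (b + 2) ((a + 2 - 1) * (b + 2 - 1)) sA :=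
    ⟨_, sweepStrat_wins (by omega) (by omega)⟩
  exact ⟨Nat.sInf_le h, h⟩
end

section
/- For every integer m ≥ 3, ESO(m,3) > m + (6m)^{1/3} − 2, where the inequality is between the natural number ESO(m,3) (viewed as a real number) and the real number m + (6m)^{1/3} − 2. -/
open Set

/-- The first `k` elements of a finite set, in the order given by an injective key. -/
theorem exists_initial_segment {γ β : Type*} [LinearOrder β] (f : γ → β) (Z : Finset γ)
    (hf : ∀ a ∈ Z, ∀ b ∈ Z, f a = f b → a = b) (k : ℕ) (hk : k ≤ Z.card) :
    ∃ Q ⊆ Z, Q.card = k ∧ ∀ q ∈ Q, ∀ z ∈ Z, z ∉ Q → f q < f z := by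
  classical
  induction k with
  | zero => exact ⟨∅, by simp, by simp, by simp⟩
  | succ k ih =>
    obtain ⟨Q, hQZ, hQ, hlt⟩ := ih (by omega)
    have hne : (Z \ Q).Nonempty := by
      rw [← Finset.card_pos, Finset.card_sdiff_of_subset hQZ]
      omega
    obtain ⟨m, hm, hmin⟩ := Finset.exists_min_image (Z \ Q) f hne
    rw [Finset.mem_sdiff] at hm
    refine ⟨insert m Q, Finset.insert_subset hm.1 hQZ, by
      rw [Finset.card_insert_of_notMem hm.2, hQ], ?_⟩
    intro q hq z hz hzQ
    rw [Finset.mem_insert, not_or] at hzQ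
    rcases Finset.mem_insert.1 hq with rfl | hq
    · refine lt_of_le_of_ne (hmin z (Finset.mem_sdiff.2 ⟨hz, hzQ.2⟩)) fun he => ?_
      exact hzQ.1 (hf _ hz _ hm.1 he.symm)
    · exact hlt q hq z hz hzQ.2

/-- A value between two finite sets of levels. -/
theorem exists_level {α β : Type*} [LinearOrder β] [DenselyOrdered β] [NoMinOrder β]
    [NoMaxOrder β] {lo hi : β} (P : Finset (α × β)) (a b : β → Prop)
    (hab : ∀ s t, a s → b t → s < t) (hlo : a lo) (hhi : b hi) :
    ∃ y, (lo < y ∧ y < hi) ∧ ∀ p ∈ P, (a p.2 → p.2 < y) ∧ (b p.2 → y < p.2) := by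
  classical
  obtain ⟨y, h1, h2⟩ := Order.exists_between_finsets (nonem := ⟨lo⟩)
    (insert lo ((P.image Prod.snd).filter a)) (insert hi ((P.image Prod.snd).filter b)) (by
      intro s hs t ht
      apply hab
      · rcases Finset.mem_insert.1 hs with rfl | hs
        exacts [hlo, (Finset.mem_filter.1 hs).2]
      · rcases Finset.mem_insert.1 ht with rfl | ht
        exacts [hhi, (Finset.mem_filter.1 ht).2])
  refine ⟨y, ⟨h1 _ (Finset.mem_insert_self _ _), h2 _ (Finset.mem_insert_self _ _)⟩,
    fun p hp => ⟨fun ha => h1 _ (Finset.mem_insert_of_mem (Finset.mem_filter.2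
      ⟨Finset.mem_image_of_mem _ hp, ha⟩)), fun hb => h2 _ (Finset.mem_insert_of_mem
      (Finset.mem_filter.2 ⟨Finset.mem_image_of_mem _ hp, hb⟩))⟩⟩

/-- The position maintained by player B in the game `A_{m,3}` after `n` moves, at level `e`.
The points `P` are split into upper points `U`, lower points `L` and an increasing set `S`.
The map `c` sends every point to an element of `S` so that distinct points with the same image
are inverted; `A ⊆ S` consists of elements that are the image of themselves only, and `Z ⊆ A` is
the free zone between the upper and the lower points. -/
structure Position {α β : Type*} [LinearOrder α] [LinearOrder β] (lo hi : β) (d n e : ℕ)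
    (P U L A S Z : Finset (α × β)) (c : α × β → α × β) : Prop where
  bound : ∀ p ∈ P, lo < p.2 ∧ p.2 < hi
  xinj : ∀ p ∈ P, ∀ q ∈ P, p.1 = q.1 → p = q
  yinj : ∀ p ∈ P, ∀ q ∈ P, p.2 = q.2 → p = q
  mem : ∀ p ∈ P, p ∈ U ∨ p ∈ L ∨ p ∈ S
  subU : U ⊆ P
  subL : L ⊆ P
  subS : S ⊆ P
  subA : A ⊆ S
  subZ : Z ⊆ A
  upper : ∀ u ∈ U, ∀ q ∈ P, q.1 < u.1 → q.2 < u.2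
  lower : ∀ l ∈ L, ∀ q ∈ P, l.1 < q.1 → l.2 < q.2
  mono : ∀ s ∈ S, ∀ t ∈ S, s.1 < t.1 → s.2 < t.2
  sep : ∀ u ∈ U, ∀ l ∈ L, u.1 < l.1 ∧ u.2 < l.2
  col_mem : ∀ p ∈ P, c p ∈ S
  col_inv : ∀ p ∈ P, ∀ q ∈ P, c p = c q → p.1 < q.1 → q.2 < p.2
  col_free : ∀ p ∈ P, c p ∈ A → c p = p
  zoneU : ∀ z ∈ Z, ∀ u ∈ U, u.1 < z.1 ∧ u.2 < z.2
  zoneL : ∀ z ∈ Z, ∀ l ∈ L, z.1 < l.1 ∧ z.2 < l.2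
  covU : ∀ u ∈ U, ∃ F ⊆ A, e ≤ F.card ∧ ∀ s ∈ F, u.1 < s.1 ∧ s.2 < u.2
  covL : ∀ l ∈ L, ∃ F ⊆ A, e ≤ F.card ∧ ∀ s ∈ F, s.1 < l.1 ∧ l.2 < s.2
  endU : 1 ≤ e → ∀ u ∈ U, ∀ s ∈ S, u.1 < s.1 → s.2 < u.2 →
    ∃ t ∈ A, s.1 ≤ t.1 ∧ ∃ v ∈ U, v.1 < t.1 ∧ t.2 < v.2
  endL : 1 ≤ e → ∀ l ∈ L, ∀ s ∈ S, s.1 < l.1 → l.2 < s.2 →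
    ∃ t ∈ A, t.1 ≤ s.1 ∧ ∃ v ∈ L, t.1 < v.1 ∧ v.2 < t.2
  count : n + e = S.card + d
  room : S.card + e.choose 3 + e + 2 * e.choose 2 ≤ (d + 2).choose 3 + Z.card
  size : S.card + e.choose 3 + e ≤ (d + 2).choose 3 + 1
  zone : e.choose 2 ≤ Z.card ∨ (U = ∅ ∧ L = ∅)

namespace Position

variable {α β : Type*} [LinearOrder α] [LinearOrder β] {lo hi : β} {d n e : ℕ}
  {P U L A S Z : Finset (α × β)} {c : α × β → α × β}

/-- Point reflection exchanges upper and lower points. -/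
theorem dual (h : Position lo hi d n e P U L A S Z c) :
    Position (α := αᵒᵈ) (β := βᵒᵈ) hi lo d n e P L U A S Z c where
  bound p hp := (h.bound p hp).symm
  xinj := h.xinj
  yinj := h.yinj
  mem p hp := by
    rcases h.mem p hp with h | h | h
    exacts [Or.inr (Or.inl h), Or.inl h, Or.inr (Or.inr h)]
  subU := h.subL
  subL := h.subU
  subS := h.subS
  subA := h.subA
  subZ := h.subZ
  upper := h.lower
  lower := h.upper
  mono s hs t ht hst := h.mono t ht s hs hst
  sep u hu l hl := h.sep l hl u hu
  col_mem := h.col_mem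
  col_inv p hp q hq hc hlt := h.col_inv q hq p hp hc.symm hlt
  col_free := h.col_free
  zoneU := h.zoneL
  zoneL := h.zoneU
  covU := h.covL
  covL := h.covU
  endU := h.endL
  endL := h.endU
  count := h.count
  room := h.room
  size := h.size
  zone := h.zone.imp_right And.symm

/-- Player B can answer the move `x` at position `P` in such a way that a position is reached. -/
def CanAnswer {α β : Type*} [LinearOrder α] [LinearOrder β] (lo hi : β) (d n : ℕ)
    (P : Finset (α × β)) (x : α) : Prop :=
  ∃ y : β, (lo < y ∧ y < hi) ∧ (∀ p ∈ P, y ≠ p.2) ∧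
    ∃ (P' U L A S Z : Finset (α × β)) (c : α × β → α × β) (e : ℕ),
      (∀ p, p ∈ P' ↔ p = (x, y) ∨ p ∈ P) ∧ Position lo hi d (n + 1) e P' U L A S Z c

theorem CanAnswer.of_dual {x : α}
    (h : CanAnswer (α := αᵒᵈ) (β := βᵒᵈ) hi lo d n P x) : CanAnswer lo hi d n P x := by
  obtain ⟨y, hy, hyP, P', U, L, A, S, Z, c, e, hP', h⟩ := h
  exact ⟨y, hy.symm, hyP, P', L, U, A, S, Z, c, e, hP', h.dual⟩

/-- An upper point that is inverted with sufficiently many elements of `A` may be played. -/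
theorem canAnswer_upper (h : Position lo hi d n (e + 1) P U L A S Z c) {x : α} {y : β}
    (hx : ∀ p ∈ P, x ≠ p.1) (hy : lo < y ∧ y < hi) (hyP : ∀ p ∈ P, y ≠ p.2)
    (hleft : ∀ q ∈ P, q.1 < x → q.2 < y) (hU : ∀ u ∈ U, x < u.1 → y < u.2)
    (hL : ∀ l ∈ L, x < l.1 ∧ y < l.2)
    (E : Finset (α × β)) (hEA : E ⊆ A) (hE : e + 1 ≤ E.card) (hEx : ∀ s ∈ E, x < s.1 ∧ s.2 < y)
    (hend : ∀ s ∈ S, x < s.1 → s.2 < y →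
      ∃ t ∈ A, s.1 ≤ t.1 ∧ ∃ v, (v = (x, y) ∨ v ∈ U) ∧ v.1 < t.1 ∧ t.2 < v.2)
    (Z' : Finset (α × β)) (hZ' : Z' ⊆ Z) (hZ'card : e.choose 2 ≤ Z'.card)
    (hZ'x : ∀ z ∈ Z', x < z.1 ∧ y < z.2) : CanAnswer lo hi d n P x := by
  classical
  have hEne : E.Nonempty := by rw [← Finset.card_pos]; omega
  obtain ⟨s₀, hs₀, hmin⟩ := Finset.exists_min_image E (fun s => s.1) hEne
  have hs₀A := hEA hs₀
  have hs₀S := h.subA hs₀A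
  have hp : (x, y) ∉ P := fun hp => hx _ hp rfl
  have hne : ∀ q ∈ P, q ≠ (x, y) := fun q hq he => hp (he ▸ hq)
  have hcq : ∀ q ∈ P, Function.update c (x, y) s₀ q = c q := fun q hq =>
    Function.update_of_ne (hne q hq) _ _
  have hcp : Function.update c (x, y) s₀ (x, y) = s₀ := Function.update_self ..
  have herase : ∀ F : Finset (α × β), e + 1 ≤ F.card → e ≤ (F.erase s₀).card := fun F hF => by
    have := Finset.pred_card_le_card_erase (s := F) (a := s₀)
    omega
  have hch : (e + 1).choose 2 = e.choose 2 + e := by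
    rw [Nat.choose_succ_succ' e 1, Nat.choose_one_right, add_comm]
  have hch3 : (e + 1).choose 3 = e.choose 3 + e.choose 2 := by
    rw [Nat.choose_succ_succ' e 2, add_comm]
  have hsize := h.size
  have hcount := h.count
  refine ⟨y, hy, hyP, insert (x, y) P, insert (x, y) U, L, A.erase s₀, S, Z',
    Function.update c (x, y) s₀, e, fun p => Finset.mem_insert, ?_⟩
  constructor
  case bound =>
    intro p hp
    rcases Finset.mem_insert.1 hp with rfl | hp
    exacts [hy, h.bound p hp]
  case xinj =>
    intro p hp q hq hpq
    rcases Finset.mem_insert.1 hp with rfl | hp <;> rcases Finset.mem_insert.1 hq with rfl | hq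
    exacts [rfl, absurd hpq (hx q hq), absurd hpq.symm (hx p hp), h.xinj p hp q hq hpq]
  case yinj =>
    intro p hp q hq hpq
    rcases Finset.mem_insert.1 hp with rfl | hp <;> rcases Finset.mem_insert.1 hq with rfl | hq
    exacts [rfl, absurd hpq (hyP q hq), absurd hpq.symm (hyP p hp), h.yinj p hp q hq hpq]
  case mem =>
    intro p hp
    rcases Finset.mem_insert.1 hp with rfl | hp
    · exact Or.inl (Finset.mem_insert_self _ _)
    · exact (h.mem p hp).imp_left fun hp => Finset.mem_insert_of_mem hp
  case subU => exact Finset.insert_subset_insert _ h.subU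
  case subL => exact h.subL.trans (Finset.subset_insert _ _)
  case subS => exact h.subS.trans (Finset.subset_insert _ _)
  case subA => exact (Finset.erase_subset _ _).trans h.subA
  case subZ =>
    intro z hz
    refine Finset.mem_erase.2 ⟨?_, h.subZ (hZ' hz)⟩
    rintro rfl
    exact lt_asymm (hZ'x _ hz).2 (hEx _ hs₀).2
  case upper =>
    intro u hu q hq hqu
    rcases Finset.mem_insert.1 hu with rfl | hu <;> rcases Finset.mem_insert.1 hq with rfl | hq
    · exact absurd hqu (lt_irrefl _)
    · exact hleft q hq hqu
    · exact hU u hu hqu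
    · exact h.upper u hu q hq hqu
  case lower =>
    intro l hl q hq hlq
    rcases Finset.mem_insert.1 hq with rfl | hq
    · exact absurd hlq (lt_asymm (hL l hl).1)
    · exact h.lower l hl q hq hlq
  case mono => exact h.mono
  case sep =>
    intro u hu l hl
    rcases Finset.mem_insert.1 hu with rfl | hu
    exacts [hL l hl, h.sep u hu l hl]
  case col_mem =>
    intro p hp
    rcases Finset.mem_insert.1 hp with rfl | hp
    · rwa [hcp]
    · rw [hcq p hp]
      exact h.col_mem p hp
  case col_inv =>
    intro p hp q hq hc hpq
    rcases Finset.mem_insert.1 hp with rfl | hp <;> rcases Finset.mem_insert.1 hq with rfl | hq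
    · exact absurd hpq (lt_irrefl _)
    · rw [hcp, hcq q hq] at hc
      have := h.col_free q hq (hc ▸ hs₀A)
      rw [← this, ← hc]
      exact (hEx _ hs₀).2
    · rw [hcp, hcq p hp] at hc
      have := h.col_free p hp (hc ▸ hs₀A)
      rw [← this, hc] at hpq
      exact absurd hpq (lt_asymm (hEx _ hs₀).1)
    · rw [hcq p hp, hcq q hq] at hc
      exact h.col_inv p hp q hq hc hpq
  case col_free =>
    intro p hp hc
    rcases Finset.mem_insert.1 hp with rfl | hp
    · rw [hcp] at hc
      exact absurd hc (Finset.notMem_erase _ _)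
    · rw [hcq p hp] at hc ⊢
      exact h.col_free p hp (Finset.mem_of_mem_erase hc)
  case zoneU =>
    intro z hz u hu
    rcases Finset.mem_insert.1 hu with rfl | hu
    exacts [hZ'x z hz, h.zoneU z (hZ' hz) u hu]
  case zoneL => exact fun z hz => h.zoneL z (hZ' hz)
  case covU =>
    intro u hu
    rcases Finset.mem_insert.1 hu with rfl | hu
    · exact ⟨E.erase s₀, Finset.erase_subset_erase _ hEA, herase E hE,
        fun s hs => hEx s (Finset.mem_of_mem_erase hs)⟩
    · obtain ⟨F, hFA, hF, hFu⟩ := h.covU u hu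
      exact ⟨F.erase s₀, Finset.erase_subset_erase _ hFA, herase F hF,
        fun s hs => hFu s (Finset.mem_of_mem_erase hs)⟩
  case covL =>
    intro l hl
    obtain ⟨F, hFA, hF, hFl⟩ := h.covL l hl
    exact ⟨F.erase s₀, Finset.erase_subset_erase _ hFA, herase F hF,
      fun s hs => hFl s (Finset.mem_of_mem_erase hs)⟩
  case endU =>
    intro he u hu s hs hus hsu
    have key : ∃ t ∈ A, s.1 ≤ t.1 ∧ ∃ v, (v = (x, y) ∨ v ∈ U) ∧ v.1 < t.1 ∧ t.2 < v.2 := by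
      rcases Finset.mem_insert.1 hu with rfl | hu
      · exact hend s hs hus hsu
      · obtain ⟨t, ht, hst, v, hv, hvt⟩ := h.endU (by omega) u hu s hs hus hsu
        exact ⟨t, ht, hst, v, Or.inr hv, hvt⟩
    obtain ⟨t, ht, hst, v, hv, hvt⟩ := key
    by_cases hts : t = s₀
    · subst hts
      have hpos : 0 < (E.erase t).card := by
        have := herase E hE
        omega
      obtain ⟨s₁, hs₁⟩ := Finset.card_pos.1 hpos
      have hs₁E := Finset.mem_of_mem_erase hs₁
      exact ⟨s₁, Finset.erase_subset_erase _ hEA hs₁, hst.trans (hmin s₁ hs₁E), (x, y),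
        Finset.mem_insert_self _ _, hEx s₁ hs₁E⟩
    · exact ⟨t, Finset.mem_erase.2 ⟨hts, ht⟩, hst, v, Finset.mem_insert.2 hv, hvt⟩
  case endL =>
    intro he l hl s hs hsl hls
    obtain ⟨t, ht, hts, v, hv, htv⟩ := h.endL (by omega) l hl s hs hsl hls
    refine ⟨t, Finset.mem_erase.2 ⟨?_, ht⟩, hts, v, hv, htv⟩
    rintro rfl
    exact lt_asymm htv.2 ((hEx _ hs₀).2.trans (hL v hv).2)
  case count => omega
  case room => omega
  case size => omega
  case zone => exact Or.inl hZ'card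

theorem fst_le_of_snd_le (h : Position lo hi d n e P U L A S Z c) {s t : α × β}
    (hs : s ∈ S) (ht : t ∈ S) (hst : s.2 ≤ t.2) : s.1 ≤ t.1 :=
  not_lt.1 fun hlt => not_lt.2 hst (h.mono t ht s hs hlt)

theorem fst_lt_of_snd_lt (h : Position lo hi d n e P U L A S Z c) {s t : α × β}
    (hs : s ∈ S) (ht : t ∈ S) (hst : s.2 < t.2) : s.1 < t.1 := by
  refine lt_of_le_of_ne (h.fst_le_of_snd_le hs ht hst.le) fun he => hst.ne ?_
  rw [h.xinj s (h.subS hs) t (h.subS ht) he]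

variable [DenselyOrdered β] [NoMinOrder β] [NoMaxOrder β]

theorem canAnswer_of_lt_upper (h : Position lo hi d n (e + 1) P U L A S Z c) {x : α}
    (hx : ∀ p ∈ P, x ≠ p.1) (hU : ∃ u ∈ U, x < u.1) : CanAnswer lo hi d n P x := by
  classical
  obtain ⟨u₀, hu₀, hxu₀⟩ := hU
  obtain ⟨u, hu, hmin⟩ := Finset.exists_min_image (U.filter fun u => x < u.1) (fun u => u.1)
    ⟨u₀, Finset.mem_filter.2 ⟨hu₀, hxu₀⟩⟩
  rw [Finset.mem_filter] at hu
  obtain ⟨huU, hxu⟩ := hu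
  have huP := h.subU huU
  obtain ⟨y, hy, hyP⟩ := exists_level P (fun b => b < u.2) (fun b => u.2 ≤ b)
    (fun s t hs ht => lt_of_lt_of_le hs ht) (h.bound u huP).1 (h.bound u huP).2.le
  have hyu : y < u.2 := (hyP u huP).2 le_rfl
  obtain ⟨F, hFA, hF, hFu⟩ := h.covU u huU
  have hFx : ∀ s ∈ F, x < s.1 ∧ s.2 < y := fun s hs =>
    ⟨hxu.trans (hFu s hs).1, (hyP s (h.subS (h.subA (hFA hs)))).1 (hFu s hs).2⟩
  have hch : (e + 1).choose 2 = e.choose 2 + e := by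
    rw [Nat.choose_succ_succ' e 1, Nat.choose_one_right, add_comm]
  refine h.canAnswer_upper hx hy (fun p hp hyp => ?_) ?_ ?_ ?_ F hFA hF hFx ?_ Z subset_rfl ?_ ?_
  · rcases lt_or_ge p.2 u.2 with hlt | hge
    exacts [((hyP p hp).1 hlt).ne' hyp, ((hyP p hp).2 hge).ne hyp]
  · exact fun q hq hqx => (hyP q hq).1 (h.upper u huU q hq (hqx.trans hxu))
  · intro v hv hxv
    refine (hyP v (h.subU hv)).2 ?_
    rcases (hmin v (Finset.mem_filter.2 ⟨hv, hxv⟩)).lt_or_eq with hlt | heq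
    · exact (h.upper v hv u huP hlt).le
    · rw [h.xinj u huP v (h.subU hv) heq]
  · exact fun l hl => ⟨hxu.trans (h.sep u huU l hl).1, hyu.trans (h.sep u huU l hl).2⟩
  · intro s hs hxs hsy
    rcases lt_or_ge u.1 s.1 with hus | hsu
    · obtain ⟨t, ht, hst, v, hv, hvt⟩ := h.endU (by omega) u huU s hs hus (hsy.trans hyu)
      exact ⟨t, ht, hst, v, Or.inr hv, hvt⟩
    · obtain ⟨t, ht⟩ := Finset.card_pos.1 (show 0 < F.card by omega)
      exact ⟨t, hFA ht, hsu.trans (hFu t ht).1.le, (x, y), Or.inl rfl, hFx t ht⟩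
  · rcases h.zone with hz | hz
    · omega
    · rw [hz.1] at huU
      exact absurd huU (Finset.notMem_empty _)
  · exact fun z hz => ⟨hxu.trans (h.zoneU z hz u huU).1, hyu.trans (h.zoneU z hz u huU).2⟩

/-- An upper point may be played just above a level `θ`, to the right of all upper points. -/
theorem canAnswer_above (h : Position lo hi d n (e + 1) P U L A S Z c) {x : α} {θ : β}
    (hx : ∀ p ∈ P, x ≠ p.1) (hθ : lo < θ ∧ θ < hi)
    (hleft : ∀ q ∈ P, q.1 < x → q.2 ≤ θ) (hU : ∀ u ∈ U, u.1 < x)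
    (hL : ∀ l ∈ L, x < l.1 ∧ θ < l.2)
    (E : Finset (α × β)) (hEA : E ⊆ A) (hE : e + 1 ≤ E.card) (hEx : ∀ s ∈ E, x < s.1 ∧ s.2 ≤ θ)
    (hend : ∀ s ∈ S, x < s.1 → s.2 ≤ θ → ∃ t ∈ E, s.1 ≤ t.1)
    (Z' : Finset (α × β)) (hZ' : Z' ⊆ Z) (hZ'card : e.choose 2 ≤ Z'.card)
    (hZ'x : ∀ z ∈ Z', x < z.1 ∧ θ < z.2) : CanAnswer lo hi d n P x := by
  obtain ⟨y, hy, hyP⟩ := exists_level P (fun b => b ≤ θ) (fun b => θ < b)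
    (fun s t hs ht => lt_of_le_of_lt hs ht) hθ.1.le hθ.2
  have hAP : A ⊆ P := h.subA.trans h.subS
  have hEy : ∀ s ∈ E, x < s.1 ∧ s.2 < y := fun s hs =>
    ⟨(hEx s hs).1, (hyP s (hAP (hEA hs))).1 (hEx s hs).2⟩
  refine h.canAnswer_upper hx hy (fun p hp hyp => ?_) ?_ ?_ ?_ E hEA hE hEy ?_ Z' hZ' hZ'card ?_
  · rcases le_or_gt p.2 θ with hle | hgt
    exacts [((hyP p hp).1 hle).ne' hyp, ((hyP p hp).2 hgt).ne hyp]
  · exact fun q hq hqx => (hyP q hq).1 (hleft q hq hqx)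
  · exact fun u hu hxu => absurd hxu (lt_asymm (hU u hu))
  · exact fun l hl => ⟨(hL l hl).1, (hyP l (h.subL hl)).2 (hL l hl).2⟩
  · intro s hs hxs hsy
    have hsθ : s.2 ≤ θ := not_lt.1 fun hlt => lt_asymm hsy ((hyP s (h.subS hs)).2 hlt)
    obtain ⟨t, ht, hst⟩ := hend s hs hxs hsθ
    exact ⟨t, hEA ht, hst, (x, y), Or.inl rfl, hEy t ht⟩
  · exact fun z hz => ⟨(hZ'x z hz).1, (hyP z (hAP (h.subZ (hZ' hz)))).2 (hZ'x z hz).2⟩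

theorem canAnswer_of_straddled (h : Position lo hi d n (e + 1) P U L A S Z c) {x : α}
    (hx : ∀ p ∈ P, x ≠ p.1) (hU : ∀ u ∈ U, u.1 < x) (hL : ∀ l ∈ L, x < l.1)
    (hstr : ∃ u ∈ U, ∃ s ∈ S, x < s.1 ∧ s.2 < u.2) : CanAnswer lo hi d n P x := by
  classical
  obtain ⟨u₀, hu₀, s₀, hs₀, hxs₀, hsu₀⟩ := hstr
  obtain ⟨u, hu, hmax⟩ := Finset.exists_max_image U (fun u => u.2) ⟨u₀, hu₀⟩
  have huP := h.subU hu
  have hsu : s₀.2 < u.2 := hsu₀.trans_le (hmax u₀ hu₀)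
  have hAP : A ⊆ P := h.subA.trans h.subS
  have hZS : Z ⊆ S := h.subZ.trans h.subA
  have hZx : ∀ z ∈ Z, x < z.1 := fun z hz =>
    hxs₀.trans (h.fst_lt_of_snd_lt hs₀ (hZS hz) (hsu.trans (h.zoneU z hz u hu).2))
  have hch : (e + 1).choose 2 = e.choose 2 + e := by
    rw [Nat.choose_succ_succ' e 1, Nat.choose_one_right, add_comm]
  have hZcard : e.choose 2 + e ≤ Z.card := by
    rcases h.zone with hz | hz
    · omega
    · rw [hz.1] at hu
      exact absurd hu (Finset.notMem_empty _)
  set C := A.filter fun s => x < s.1 ∧ s.2 < u.2 with hC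
  have hCu : ∀ s ∈ S, x < s.1 → s.2 < u.2 → ∃ t ∈ C, s.1 ≤ t.1 := by
    intro s hs hxs hsu
    obtain ⟨t, ht, hst, v, hv, hvt⟩ := h.endU (by omega) u hu s hs ((hU u hu).trans hxs) hsu
    exact ⟨t, Finset.mem_filter.2 ⟨ht, hxs.trans_le hst, hvt.2.trans_le (hmax v hv)⟩, hst⟩
  have hCpos : 0 < C.card := by
    obtain ⟨t, ht, -⟩ := hCu s₀ hs₀ hxs₀ hsu
    exact Finset.card_pos.2 ⟨t, ht⟩
  obtain ⟨Q, hQZ, hQ, hQlt⟩ := exists_initial_segment Prod.snd Z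
    (fun a ha b hb => h.yinj a (h.subS (hZS ha)) b (h.subS (hZS hb))) (e + 1 - C.card) (by omega)
  obtain ⟨m, hm, hmmax⟩ := Finset.exists_max_image (insert u Q) (fun p => p.2)
    ⟨u, Finset.mem_insert_self _ _⟩
  have hum : u.2 ≤ m.2 := hmmax u (Finset.mem_insert_self _ _)
  have hmP : m ∈ P := by
    rcases Finset.mem_insert.1 hm with rfl | hm
    exacts [huP, h.subS (hZS (hQZ hm))]
  refine h.canAnswer_above hx (h.bound m hmP) ?_ hU ?_ (C ∪ Q) ?_ ?_ ?_ ?_ (Z \ Q)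
    Finset.sdiff_subset ?_ ?_
  · intro q hq hqx
    refine le_trans ?_ hum
    rcases h.mem q hq with hq | hq | hq
    · exact hmax q hq
    · exact absurd hqx (lt_asymm (hL q hq))
    · exact ((h.mono q hq s₀ hs₀ (hqx.trans hxs₀)).trans hsu).le
  · intro l hl
    refine ⟨hL l hl, ?_⟩
    rcases Finset.mem_insert.1 hm with rfl | hm
    exacts [(h.sep _ hu l hl).2, (h.zoneL m (hQZ hm) l hl).2]
  · exact Finset.union_subset (Finset.filter_subset _ _) (hQZ.trans h.subZ)
  · rw [Finset.card_union_of_disjoint, hQ]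
    · omega
    · refine Finset.disjoint_left.2 fun s hs hsQ => ?_
      exact lt_asymm (Finset.mem_filter.1 hs).2.2 (h.zoneU s (hQZ hsQ) u hu).2
  · intro s hs
    rcases Finset.mem_union.1 hs with hs | hs
    · exact ⟨(Finset.mem_filter.1 hs).2.1, (Finset.mem_filter.1 hs).2.2.le.trans hum⟩
    · exact ⟨hZx s (hQZ hs), hmmax s (Finset.mem_insert_of_mem hs)⟩
  · intro s hs hxs hsm
    rcases Finset.mem_insert.1 hm with rfl | hm
    · have hlt : s.2 < m.2 := by
        refine lt_of_le_of_ne hsm fun he => ?_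
        rw [h.yinj s (h.subS hs) m hmP he] at hxs
        exact lt_asymm hxs (hU _ hu)
      obtain ⟨t, ht, hst⟩ := hCu s hs hxs hlt
      exact ⟨t, Finset.mem_union_left _ ht, hst⟩
    · exact ⟨m, Finset.mem_union_right _ hm, h.fst_le_of_snd_le hs (hZS (hQZ hm)) hsm⟩
  · rw [Finset.card_sdiff_of_subset hQZ]
    omega
  · intro z hz
    rw [Finset.mem_sdiff] at hz
    refine ⟨hZx z hz.1, ?_⟩
    rcases Finset.mem_insert.1 hm with rfl | hm
    exacts [(h.zoneU z hz.1 _ hu).2, hQlt m hm z hz.1 hz.2]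

theorem canAnswer_of_large_zone (h : Position lo hi d n (e + 1) P U L A S Z c) {x : α}
    (hx : ∀ p ∈ P, x ≠ p.1) (hU : ∀ u ∈ U, u.1 < x) (hL : ∀ l ∈ L, x < l.1)
    (R : Finset (α × β)) (hRZ : R ⊆ Z) (hRx : ∀ z ∈ R, x < z.1)
    (hR : e.choose 2 + e + 1 ≤ R.card) : CanAnswer lo hi d n P x := by
  classical
  have hZS : Z ⊆ S := h.subZ.trans h.subA
  have hRS : R ⊆ S := hRZ.trans hZS
  obtain ⟨Q, hQR, hQ, hQlt⟩ := exists_initial_segment Prod.snd R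
    (fun a ha b hb => h.yinj a (h.subS (hRS ha)) b (h.subS (hRS hb))) (e + 1) (by omega)
  obtain ⟨m, hm, hmmax⟩ := Finset.exists_max_image Q (fun p => p.2)
    (Finset.card_pos.1 (by omega))
  have hmS := hRS (hQR hm)
  have hmZ := hRZ (hQR hm)
  refine h.canAnswer_above hx (h.bound m (h.subS hmS)) ?_ hU ?_ Q ?_ hQ.ge ?_ ?_ (R \ Q)
    (Finset.sdiff_subset.trans hRZ) ?_ ?_
  · intro q hq hqx
    rcases h.mem q hq with hq | hq | hq
    · exact (h.zoneU m hmZ q hq).2.le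
    · exact absurd hqx (lt_asymm (hL q hq))
    · exact (h.mono q hq m hmS (hqx.trans (hRx m (hQR hm)))).le
  · exact fun l hl => ⟨hL l hl, (h.zoneL m hmZ l hl).2⟩
  · exact hQR.trans (hRZ.trans h.subZ)
  · exact fun s hs => ⟨hRx s (hQR hs), hmmax s hs⟩
  · exact fun s hs hxs hsm => ⟨m, hm, h.fst_le_of_snd_le hs hmS hsm⟩
  · rw [Finset.card_sdiff_of_subset hQR]
    omega
  · intro z hz
    rw [Finset.mem_sdiff] at hz
    exact ⟨hRx z hz.1, hQlt m hm z hz.1 hz.2⟩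

/-- If the zone is small and no inversion straddles `x`, then a free point may be played. -/
theorem canAnswer_of_small_zone (h : Position lo hi d n e P U L A S Z c) {x : α}
    (hx : ∀ p ∈ P, x ≠ p.1) (hU : ∀ u ∈ U, u.1 < x) (hL : ∀ l ∈ L, x < l.1)
    (hstrU : ∀ u ∈ U, ∀ s ∈ S, x < s.1 → u.2 < s.2)
    (hstrL : ∀ l ∈ L, ∀ s ∈ S, s.1 < x → s.2 < l.2)
    (hlo : lo < hi) (hZ : Z.card ≤ 2 * e.choose 2) : CanAnswer lo hi d n P x := by
  classical
  have hcross : ∀ p ∈ P, ∀ q ∈ P, p.1 < x → x < q.1 → p.2 < q.2 := by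
    intro p hp q hq hpx hxq
    rcases h.mem q hq with hqU | hqL | hqS
    · exact absurd hxq (lt_asymm (hU q hqU))
    · rcases h.mem p hp with hpU | hpL | hpS
      exacts [(h.sep p hpU q hqL).2, absurd hpx (lt_asymm (hL p hpL)), hstrL q hqL p hpS hpx]
    · rcases h.mem p hp with hpU | hpL | hpS
      exacts [hstrU p hpU q hqS hxq, absurd hpx (lt_asymm (hL p hpL)),
        h.mono p hpS q hqS (hpx.trans hxq)]
  obtain ⟨y, hy, hyP⟩ := exists_level (lo := lo) (hi := hi) P
    (fun b => b = lo ∨ ∃ p ∈ P, p.1 < x ∧ p.2 = b) (fun b => b = hi ∨ ∃ p ∈ P, x < p.1 ∧ p.2 = b)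
    (by
      rintro s t (rfl | ⟨p, hp, hpx, rfl⟩) (rfl | ⟨q, hq, hxq, rfl⟩)
      exacts [hlo, (h.bound q hq).1, (h.bound p hp).2, hcross p hp q hq hpx hxq])
    (Or.inl rfl) (Or.inl rfl)
  have hyl : ∀ p ∈ P, p.1 < x → p.2 < y := fun p hp hpx =>
    (hyP p hp).1 (Or.inr ⟨p, hp, hpx, rfl⟩)
  have hyr : ∀ p ∈ P, x < p.1 → y < p.2 := fun p hp hpx =>
    (hyP p hp).2 (Or.inr ⟨p, hp, hpx, rfl⟩)
  have hyne : ∀ p ∈ P, y ≠ p.2 := by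
    intro p hp
    rcases (hx p hp).lt_or_gt with hlt | hgt
    exacts [(hyr p hp hlt).ne, (hyl p hp hgt).ne']
  have hp : (x, y) ∉ P := fun hp => hx _ hp rfl
  have hpS : (x, y) ∉ S := fun hs => hp (h.subS hs)
  have hpZ : (x, y) ∉ Z := fun hz => hpS (h.subA (h.subZ hz))
  have hne : ∀ q ∈ P, q ≠ (x, y) := fun q hq he => hp (he ▸ hq)
  have hcq : ∀ q ∈ P, Function.update c (x, y) (x, y) q = c q := fun q hq =>
    Function.update_of_ne (hne q hq) _ _
  have hcp : Function.update c (x, y) (x, y) (x, y) = (x, y) := Function.update_self ..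
  have hcne : ∀ q ∈ P, c q ≠ (x, y) := fun q hq he => hpS (he ▸ h.col_mem q hq)
  have hroom := h.room
  have hcount := h.count
  have hScard := Finset.card_insert_of_notMem hpS
  have hZcard := Finset.card_insert_of_notMem hpZ
  refine ⟨y, hy, hyne, insert (x, y) P, U, L, insert (x, y) A, insert (x, y) S, insert (x, y) Z,
    Function.update c (x, y) (x, y), e, fun p => Finset.mem_insert, ?_⟩
  constructor
  case bound =>
    intro p hp
    rcases Finset.mem_insert.1 hp with rfl | hp
    exacts [hy, h.bound p hp]
  case xinj =>
    intro p hp q hq hpq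
    rcases Finset.mem_insert.1 hp with rfl | hp <;> rcases Finset.mem_insert.1 hq with rfl | hq
    exacts [rfl, absurd hpq (hx q hq), absurd hpq.symm (hx p hp), h.xinj p hp q hq hpq]
  case yinj =>
    intro p hp q hq hpq
    rcases Finset.mem_insert.1 hp with rfl | hp <;> rcases Finset.mem_insert.1 hq with rfl | hq
    exacts [rfl, absurd hpq (hyne q hq), absurd hpq.symm (hyne p hp), h.yinj p hp q hq hpq]
  case mem =>
    intro p hp
    rcases Finset.mem_insert.1 hp with rfl | hp
    · exact Or.inr (Or.inr (Finset.mem_insert_self _ _))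
    · exact (h.mem p hp).imp_right (Or.imp_right fun hp => Finset.mem_insert_of_mem hp)
  case subU => exact h.subU.trans (Finset.subset_insert _ _)
  case subL => exact h.subL.trans (Finset.subset_insert _ _)
  case subS => exact Finset.insert_subset_insert _ h.subS
  case subA => exact Finset.insert_subset_insert _ h.subA
  case subZ => exact Finset.insert_subset_insert _ h.subZ
  case upper =>
    intro u hu q hq hqu
    rcases Finset.mem_insert.1 hq with rfl | hq
    · exact absurd hqu (lt_asymm (hU u hu))
    · exact h.upper u hu q hq hqu
  case lower =>
    intro l hl q hq hlq
    rcases Finset.mem_insert.1 hq with rfl | hq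
    · exact absurd hlq (lt_asymm (hL l hl))
    · exact h.lower l hl q hq hlq
  case mono =>
    intro s hs t ht hst
    rcases Finset.mem_insert.1 hs with rfl | hs <;> rcases Finset.mem_insert.1 ht with rfl | ht
    exacts [absurd hst (lt_irrefl _), hyr t (h.subS ht) hst, hyl s (h.subS hs) hst,
      h.mono s hs t ht hst]
  case sep => exact h.sep
  case col_mem =>
    intro p hp
    rcases Finset.mem_insert.1 hp with rfl | hp
    · rw [hcp]
      exact Finset.mem_insert_self _ _
    · rw [hcq p hp]
      exact Finset.mem_insert_of_mem (h.col_mem p hp)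
  case col_inv =>
    intro p hp q hq hc hpq
    rcases Finset.mem_insert.1 hp with rfl | hp <;> rcases Finset.mem_insert.1 hq with rfl | hq
    · exact absurd hpq (lt_irrefl _)
    · rw [hcp, hcq q hq] at hc
      exact absurd hc.symm (hcne q hq)
    · rw [hcp, hcq p hp] at hc
      exact absurd hc (hcne p hp)
    · rw [hcq p hp, hcq q hq] at hc
      exact h.col_inv p hp q hq hc hpq
  case col_free =>
    intro p hp hc
    rcases Finset.mem_insert.1 hp with rfl | hp
    · exact hcp
    · rw [hcq p hp] at hc ⊢
      exact h.col_free p hp (Finset.mem_of_mem_insert_of_ne hc (hcne p hp))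
  case zoneU =>
    intro z hz u hu
    rcases Finset.mem_insert.1 hz with rfl | hz
    exacts [⟨hU u hu, hyl u (h.subU hu) (hU u hu)⟩, h.zoneU z hz u hu]
  case zoneL =>
    intro z hz l hl
    rcases Finset.mem_insert.1 hz with rfl | hz
    exacts [⟨hL l hl, hyr l (h.subL hl) (hL l hl)⟩, h.zoneL z hz l hl]
  case covU =>
    intro u hu
    obtain ⟨F, hFA, hF⟩ := h.covU u hu
    exact ⟨F, hFA.trans (Finset.subset_insert _ _), hF⟩
  case covL =>
    intro l hl
    obtain ⟨F, hFA, hF⟩ := h.covL l hl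
    exact ⟨F, hFA.trans (Finset.subset_insert _ _), hF⟩
  case endU =>
    intro he u hu s hs hus hsu
    rcases Finset.mem_insert.1 hs with rfl | hs
    · exact absurd hsu (lt_asymm (hyl u (h.subU hu) (hU u hu)))
    · obtain ⟨t, ht, hst⟩ := h.endU he u hu s hs hus hsu
      exact ⟨t, Finset.mem_insert_of_mem ht, hst⟩
  case endL =>
    intro he l hl s hs hsl hls
    rcases Finset.mem_insert.1 hs with rfl | hs
    · exact absurd hls (lt_asymm (hyr l (h.subL hl) (hL l hl)))
    · obtain ⟨t, ht, hst⟩ := h.endL he l hl s hs hsl hls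
      exact ⟨t, Finset.mem_insert_of_mem ht, hst⟩
  case count => omega
  case room => omega
  case size => omega
  case zone => exact h.zone.imp_left fun hz => by omega

/-- Player B can answer every move as long as the level is positive. -/
theorem canAnswer (h : Position lo hi d n (e + 1) P U L A S Z c) (hlo : lo < hi) {x : α}
    (hx : ∀ p ∈ P, x ≠ p.1) : CanAnswer lo hi d n P x := by
  classical
  by_cases hU : ∃ u ∈ U, x < u.1
  · exact h.canAnswer_of_lt_upper hx hU
  by_cases hL : ∃ l ∈ L, l.1 < x
  · exact (h.dual.canAnswer_of_lt_upper hx hL).of_dual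
  push Not at hU hL
  replace hU : ∀ u ∈ U, u.1 < x := fun u hu => (hU u hu).lt_of_ne (hx u (h.subU hu)).symm
  replace hL : ∀ l ∈ L, x < l.1 := fun l hl => (hL l hl).lt_of_ne (hx l (h.subL hl))
  by_cases hsU : ∃ u ∈ U, ∃ s ∈ S, x < s.1 ∧ s.2 < u.2
  · exact h.canAnswer_of_straddled hx hU hL hsU
  by_cases hsL : ∃ l ∈ L, ∃ s ∈ S, s.1 < x ∧ l.2 < s.2
  · exact (h.dual.canAnswer_of_straddled hx hL hU hsL).of_dual
  push Not at hsU hsL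
  have hch : (e + 1).choose 2 = e.choose 2 + e := by
    rw [Nat.choose_succ_succ' e 1, Nat.choose_one_right, add_comm]
  rcases le_or_gt Z.card (2 * (e + 1).choose 2) with hZ | hZ
  · refine h.canAnswer_of_small_zone hx hU hL (fun u hu s hs hxs => ?_) (fun l hl s hs hsx => ?_)
      hlo hZ
    · refine (hsU u hu s hs hxs).lt_of_ne fun he => ?_
      rw [← h.yinj u (h.subU hu) s (h.subS hs) he] at hxs
      exact lt_asymm hxs (hU u hu)
    · refine (hsL l hl s hs hsx).lt_of_ne fun he => ?_
      rw [h.yinj s (h.subS hs) l (h.subL hl) he] at hsx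
      exact lt_asymm hsx (hL l hl)
  · have hsplit := Finset.card_filter_add_card_filter_not (s := Z) (fun z => x < z.1)
    rcases le_or_gt (e.choose 2 + e + 1) (Z.filter fun z => x < z.1).card with hr | hr
    · exact h.canAnswer_of_large_zone hx hU hL _ (Finset.filter_subset _ _)
        (fun z hz => (Finset.mem_filter.1 hz).2) hr
    · obtain ⟨R, hRZ, hRx, hR⟩ : ∃ R ⊆ Z, (∀ z ∈ R, z.1 < x) ∧ e.choose 2 + e + 1 ≤ R.card := by
        refine ⟨Z.filter fun z => ¬ x < z.1, Finset.filter_subset _ _, fun z hz => ?_, by omega⟩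
        rw [Finset.mem_filter, not_lt] at hz
        exact hz.2.lt_of_ne (hx z (h.subS (h.subA (h.subZ hz.1)))).symm
      exact (h.dual.canAnswer_of_large_zone hx hL hU R hRZ hRx hR).of_dual

end Position
/-- The position maintained by player B at level `0`: there is no 3-down-run, and `c` covers the
points by increasing chains in such a way that distinct points with the same image are inverted. -/
structure Endgame {α β : Type*} [LinearOrder α] [LinearOrder β] (lo hi : β) (d n : ℕ)
    (P S : Finset (α × β)) (c : α × β → α × β) : Prop where
  bound : ∀ p ∈ P, lo < p.2 ∧ p.2 < hi
  yinj : ∀ p ∈ P, ∀ q ∈ P, p.2 = q.2 → p = q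
  subS : S ⊆ P
  col_mem : ∀ p ∈ P, c p ∈ S
  col_inv : ∀ p ∈ P, ∀ q ∈ P, c p = c q → p.1 < q.1 → q.2 < p.2
  no_down : ∀ p ∈ P, ∀ q ∈ P, ∀ r ∈ P, p.1 < q.1 → q.1 < r.1 → q.2 < p.2 → ¬ r.2 < q.2
  count : n = S.card + d

namespace Position

variable {α β : Type*} [LinearOrder α] [LinearOrder β] {lo hi : β} {d n e : ℕ}
  {P U L A S Z : Finset (α × β)} {c : α × β → α × β}

theorem no_down (h : Position lo hi d n e P U L A S Z c) (p : α × β) (hp : p ∈ P) (q : α × β)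
    (hq : q ∈ P) (r : α × β) (hr : r ∈ P) (hpq : p.1 < q.1) (hqr : q.1 < r.1) (hqp : q.2 < p.2) :
    ¬ r.2 < q.2 := by
  intro hrq
  have hqS : q ∈ S := by
    rcases h.mem q hq with hq' | hq' | hq'
    exacts [absurd hqp (lt_asymm (h.upper q hq' p hp hpq)),
      absurd hrq (lt_asymm (h.lower q hq' r hr hqr)), hq']
  have hpU : p ∈ U := by
    rcases h.mem p hp with hp' | hp' | hp'
    exacts [hp', absurd hqp (lt_asymm (h.lower p hp' q hq hpq)),
      absurd hqp (lt_asymm (h.mono p hp' q hqS hpq))]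
  have hrL : r ∈ L := by
    rcases h.mem r hr with hr' | hr' | hr'
    exacts [absurd hrq (lt_asymm (h.upper r hr' q hq hqr)), hr',
      absurd hrq (lt_asymm (h.mono q hqS r hr' hqr))]
  exact lt_asymm (hrq.trans hqp) (h.sep p hpU r hrL).2

theorem endgame (h : Position lo hi d n 0 P U L A S Z c) : Endgame lo hi d n P S c where
  bound := h.bound
  yinj := h.yinj
  subS := h.subS
  col_mem := h.col_mem
  col_inv := h.col_inv
  no_down := h.no_down
  count := h.count

theorem initial (lo hi : β) (d : ℕ) :
    Position (α := α) lo hi d 0 d ∅ ∅ ∅ ∅ ∅ ∅ id := by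
  have h1 : (d + 2).choose 3 = (d + 1).choose 3 + (d + 1).choose 2 := by
    rw [Nat.choose_succ_succ' (d + 1) 2, add_comm]
  have h2 : (d + 1).choose 3 = d.choose 3 + d.choose 2 := by
    rw [Nat.choose_succ_succ' d 2, add_comm]
  have h3 : (d + 1).choose 2 = d.choose 2 + d := by
    rw [Nat.choose_succ_succ' d 1, Nat.choose_one_right, add_comm]
  constructor
  case room =>
    rw [Finset.card_empty]
    omega
  case size =>
    rw [Finset.card_empty]
    omega
  case count => simp
  all_goals simp

end Position

namespace Endgame

variable {α β : Type*} [LinearOrder α] [LinearOrder β] {lo hi : β} {d n : ℕ}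
  {P S : Finset (α × β)} {c : α × β → α × β}

theorem exists_answer [DenselyOrdered β] [NoMinOrder β] [NoMaxOrder β]
    (h : Endgame lo hi d n P S c) (hlo : lo < hi) {x : α} (hx : ∀ p ∈ P, x ≠ p.1)
    (P' : β → Finset (α × β)) (hP' : ∀ y p, p ∈ P' y ↔ p = (x, y) ∨ p ∈ P) :
    ∃ y, (lo < y ∧ y < hi) ∧ (∀ p ∈ P, y ≠ p.2) ∧
      ∃ S' c', Endgame lo hi d (n + 1) (P' y) S' c' := by
  classical
  obtain ⟨M, hM, hmax⟩ := Finset.exists_max_image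
    (insert lo ((P.filter fun p => p.1 < x).image Prod.snd)) id ⟨lo, Finset.mem_insert_self _ _⟩
  have hM' : M = lo ∨ ∃ p ∈ P, p.1 < x ∧ p.2 = M := by
    rcases Finset.mem_insert.1 hM with hM | hM
    · exact Or.inl hM
    · obtain ⟨p, hp, rfl⟩ := Finset.mem_image.1 hM
      rw [Finset.mem_filter] at hp
      exact Or.inr ⟨p, hp.1, hp.2, rfl⟩
  have hleft : ∀ p ∈ P, p.1 < x → p.2 ≤ M := fun p hp hpx =>
    hmax _ (Finset.mem_insert_of_mem (Finset.mem_image_of_mem _ (Finset.mem_filter.2 ⟨hp, hpx⟩)))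
  have hMhi : M < hi := by
    rcases hM' with rfl | ⟨p, hp, -, rfl⟩
    exacts [hlo, (h.bound p hp).2]
  obtain ⟨y, hy, hyP⟩ := exists_level P (fun b => b ≤ M) (fun b => M < b)
    (fun s t hs ht => hs.trans_lt ht) (hmax lo (Finset.mem_insert_self _ _)) hMhi
  have hyl : ∀ p ∈ P, p.1 < x → p.2 < y := fun p hp hpx => (hyP p hp).1 (hleft p hp hpx)
  have hyne : ∀ p ∈ P, y ≠ p.2 := by
    intro p hp hyp
    rcases le_or_gt p.2 M with hle | hgt
    exacts [((hyP p hp).1 hle).ne' hyp, ((hyP p hp).2 hgt).ne hyp]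
  have hp : (x, y) ∉ P := fun hp => hx _ hp rfl
  have hpS : (x, y) ∉ S := fun hs => hp (h.subS hs)
  have hne : ∀ q ∈ P, q ≠ (x, y) := fun q hq he => hp (he ▸ hq)
  have hcq : ∀ q ∈ P, Function.update c (x, y) (x, y) q = c q := fun q hq =>
    Function.update_of_ne (hne q hq) _ _
  have hcp : Function.update c (x, y) (x, y) (x, y) = (x, y) := Function.update_self ..
  have hcne : ∀ q ∈ P, c q ≠ (x, y) := fun q hq he => hpS (he ▸ h.col_mem q hq)
  have hcount := h.count
  have hScard := Finset.card_insert_of_notMem hpS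
  refine ⟨y, hy, hyne, insert (x, y) S, Function.update c (x, y) (x, y), ?_⟩
  constructor
  case bound =>
    intro p hp
    rcases (hP' y p).1 hp with rfl | hp
    exacts [hy, h.bound p hp]
  case yinj =>
    intro p hp q hq hpq
    rcases (hP' y p).1 hp with rfl | hp <;> rcases (hP' y q).1 hq with rfl | hq
    exacts [rfl, absurd hpq (hyne q hq), absurd hpq.symm (hyne p hp), h.yinj p hp q hq hpq]
  case subS =>
    intro s hs
    exact (hP' y s).2 ((Finset.mem_insert.1 hs).imp_right fun hs => h.subS hs)
  case col_mem =>
    intro p hp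
    rcases (hP' y p).1 hp with rfl | hp
    · rw [hcp]
      exact Finset.mem_insert_self _ _
    · rw [hcq p hp]
      exact Finset.mem_insert_of_mem (h.col_mem p hp)
  case col_inv =>
    intro p hp q hq hc hpq
    rcases (hP' y p).1 hp with rfl | hp <;> rcases (hP' y q).1 hq with rfl | hq
    · exact absurd hpq (lt_irrefl _)
    · rw [hcp, hcq q hq] at hc
      exact absurd hc.symm (hcne q hq)
    · rw [hcp, hcq p hp] at hc
      exact absurd hc (hcne p hp)
    · rw [hcq p hp, hcq q hq] at hc
      exact h.col_inv p hp q hq hc hpq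
  case no_down =>
    have hmem : ∀ p ∈ P' y, ∀ q ∈ P' y, p.1 < q.1 → q.2 < p.2 → q ∈ P := by
      intro p hp q hq hpq hqp
      rcases (hP' y q).1 hq with rfl | hq
      · rcases (hP' y p).1 hp with rfl | hp
        exacts [absurd hpq (lt_irrefl _), absurd hqp (lt_asymm (hyl p hp hpq))]
      · exact hq
    intro p hp q hq r hr hpq hqr hqp hrq
    have hqP := hmem p hp q hq hpq hqp
    have hrP := hmem q hq r hr hqr hrq
    rcases (hP' y p).1 hp with rfl | hp
    · have hqM : q.2 ≤ M := not_lt.1 fun hlt => lt_asymm hqp ((hyP q hqP).2 hlt)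
      rcases hM' with rfl | ⟨t, ht, htx, rfl⟩
      · exact not_lt.2 hqM (h.bound q hqP).1
      · have htq : t.1 < q.1 := htx.trans hpq
        refine h.no_down t ht q hqP r hrP htq hqr (hqM.lt_of_ne fun he => ?_) hrq
        exact htq.ne (by rw [h.yinj q hqP t ht he])
    · exact h.no_down p hp q hqP r hrP hpq hqr hqp hrq
  case count => omega

theorem le_card_of_monotone (h : Endgame lo hi d n P S c) {m : ℕ} (f : Fin m → α × β)
    (hf : ∀ i, f i ∈ P) (hx : StrictMono fun i => (f i).1) (hy : Monotone fun i => (f i).2) :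
    m ≤ S.card := by
  have hcard : (Finset.univ : Finset (Fin m)).card ≤ S.card := by
    refine Finset.card_le_card_of_injOn (fun i => c (f i)) (fun i _ => h.col_mem _ (hf i)) ?_
    intro i _ j _ hij
    by_contra hne
    rcases lt_or_gt_of_ne hne with hlt | hlt
    · exact not_lt.2 (hy hlt.le) (h.col_inv _ (hf i) _ (hf j) hij (hx hlt))
    · exact not_lt.2 (hy hlt.le) (h.col_inv _ (hf j) _ (hf i) hij.symm (hx hlt))
  simpa using hcard

end Endgame

/-- Player B is still following the strategy after the points in `h` have been played. -/
def IsSafe (d : ℕ) (h : List Pt) : Prop :=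
  (∃ U L A S Z c e, Position (0 : ℝ) 1 d h.length (e + 1) h.toFinset U L A S Z c) ∨
    ∃ S c, Endgame (0 : ℝ) 1 d h.length h.toFinset S c

theorem Position.isSafe {d e : ℕ} {h : List Pt} {U L A S Z : Finset Pt} {c : Pt → Pt}
    (H : Position (0 : ℝ) 1 d h.length e h.toFinset U L A S Z c) : IsSafe d h := by
  cases e with
  | zero => exact Or.inr ⟨S, c, H.endgame⟩
  | succ e => exact Or.inl ⟨U, L, A, S, Z, c, e, H⟩

theorem isSafe_nil (d : ℕ) : IsSafe d [] :=
  Position.isSafe (h := []) (Position.initial 0 1 d)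

theorem IsSafe.exists_answer {d : ℕ} {h : List Pt} (H : IsSafe d h) {x : ℝ}
    (hx : ∀ p ∈ h, x ≠ p.1) :
    ∃ y ∈ Ioo (0 : ℝ) 1, (∀ p ∈ h, y ≠ p.2) ∧ IsSafe d (h ++ [(x, y)]) := by
  have hx' : ∀ p ∈ h.toFinset, x ≠ p.1 := fun p hp => hx p (List.mem_toFinset.1 hp)
  have hlen : ∀ y : ℝ, (h ++ [(x, y)]).length = h.length + 1 := by simp
  have hmem : ∀ (y : ℝ) (p : Pt), p ∈ (h ++ [(x, y)]).toFinset ↔ p = (x, y) ∨ p ∈ h.toFinset := by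
    intro y p
    rw [List.mem_toFinset, List.mem_append, List.mem_singleton, List.mem_toFinset, or_comm]
  rcases H with ⟨U, L, A, S, Z, c, e, H⟩ | ⟨S, c, H⟩
  · obtain ⟨y, hy, hyP, P', U, L, A, S, Z, c, e, hP', H⟩ := H.canAnswer zero_lt_one hx'
    have hP : P' = (h ++ [(x, y)]).toFinset := Finset.ext fun p => by rw [hP', hmem]
    rw [hP, ← hlen y] at H
    exact ⟨y, hy, fun p hp => hyP p (List.mem_toFinset.2 hp), H.isSafe⟩
  · obtain ⟨y, hy, hyP, S', c', H⟩ := H.exists_answer zero_lt_one hx' _ hmem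
    rw [← hlen y] at H
    exact ⟨y, hy, fun p hp => hyP p (List.mem_toFinset.2 hp), Or.inr ⟨S', c', H⟩⟩

theorem exists_fresh_level (h : List Pt) : ∃ y ∈ Ioo (0 : ℝ) 1, ∀ p ∈ h, y ≠ p.2 := by
  obtain ⟨y, hy, hyh⟩ := (Ioo_infinite (zero_lt_one' ℝ)).exists_notMem_finset
    (h.map Prod.snd).toFinset
  refine ⟨y, hy, fun p hp he => hyh ?_⟩
  rw [List.mem_toFinset, he]
  exact List.mem_map_of_mem hp

theorem exists_safe_strategy (d : ℕ) : ∃ sB : BStrat, BValid sB ∧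
    ∀ h x, IsSafe d h → (∀ p ∈ h, x ≠ p.1) → IsSafe d (h ++ [(x, sB h x)]) := by
  have key : ∀ (h : List Pt) (x : ℝ), ∃ y, (y ∈ Ioo (0 : ℝ) 1 ∧ ∀ p ∈ h, y ≠ p.2) ∧
      (IsSafe d h → (∀ p ∈ h, x ≠ p.1) → IsSafe d (h ++ [(x, y)])) := by
    intro h x
    by_cases H : IsSafe d h ∧ ∀ p ∈ h, x ≠ p.1
    · obtain ⟨y, hy, hyh, hs⟩ := H.1.exists_answer H.2
      exact ⟨y, ⟨hy, hyh⟩, fun _ _ => hs⟩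
    · obtain ⟨y, hy, hyh⟩ := exists_fresh_level h
      exact ⟨y, ⟨hy, hyh⟩, fun h1 h2 => absurd ⟨h1, h2⟩ H⟩
  choose sB hB hsafe using key
  exact ⟨sB, hB, hsafe⟩

theorem length_hist (sA : AStrat) (sB : BStrat) (n : ℕ) : (hist sA sB n).length = n := by
  induction n with
  | zero => rfl
  | succ n ih => simp [hist, ih]

theorem played_mono (sA : AStrat) (sB : BStrat) : Monotone (played sA sB) :=
  monotone_nat_of_le_succ fun _ _ hp => List.mem_append_left _ hp

theorem AWinsBy.mono {m k N N' : ℕ} {sA : AStrat} (h : AWinsBy m k N sA) (hN : N ≤ N') :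
    AWinsBy m k N' sA := by
  refine ⟨h.1, fun sB hB => ?_⟩
  have hsub := played_mono sA sB hN
  rcases h.2 sB hB with ⟨f, hf, hxy⟩ | ⟨f, hf, hxy⟩
  exacts [Or.inl ⟨f, fun i => hsub (hf i), hxy⟩, Or.inr ⟨f, fun i => hsub (hf i), hxy⟩]

/-- Player B can survive `m + d - 1` turns of the game `A_{m,3}`. -/
theorem AWinsBy.add_le {m N d : ℕ} {sA : AStrat} (h : AWinsBy m 3 N sA)
    (hm : (d + 2).choose 3 < m) : m + d ≤ N := by
  by_contra! hN
  obtain ⟨hA, hwin⟩ := h.mono (Nat.le_sub_one_of_lt hN)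
  obtain ⟨sB, hB, hsafe⟩ := exists_safe_strategy d
  have hs : ∀ n, IsSafe d (hist sA sB n) := by
    intro n
    induction n with
    | zero => exact isSafe_nil d
    | succ n ih => exact hsafe _ _ ih (hA _).2
  specialize hs (m + d - 1)
  rw [IsSafe, length_hist] at hs
  rcases hs with ⟨U, L, A, S, Z, c, e, H⟩ | ⟨S, c, H⟩
  · have := H.count
    have := H.size
    omega
  · rcases hwin sB hB with ⟨f, hf, hx, hy⟩ | ⟨f, hf, hx, hy⟩
    · have := H.le_card_of_monotone f (fun i => List.mem_toFinset.2 (hf i)) hx hy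
      have := H.count
      omega
    · exact H.no_down _ (List.mem_toFinset.2 (hf 0)) _ (List.mem_toFinset.2 (hf 1)) _
        (List.mem_toFinset.2 (hf 2)) (hx (by decide)) (hx (by decide)) (hy (by decide))
        (hy (by decide))

/-- `k` steps up can be made in `y` along increasing indices ending at `i`. -/
def ClimbsTo (y : ℕ → ℝ) : ℕ → ℕ → Prop
  | 0, _ => True
  | k + 1, i => ∃ j < i, y j < y i ∧ ClimbsTo y k j

theorem ClimbsTo.exists_index {y : ℕ → ℝ} {k i : ℕ} (h : ClimbsTo y k i) :
    ∃ g : ℕ → ℕ, g k = i ∧ ∀ j < k, g j < g (j + 1) ∧ y (g j) < y (g (j + 1)) := by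
  induction k generalizing i with
  | zero => exact ⟨fun _ => i, rfl, by simp⟩
  | succ k ih =>
    obtain ⟨l, hl, hy, h⟩ := h
    obtain ⟨g, hg, hstep⟩ := ih h
    refine ⟨Function.update g (k + 1) i, Function.update_self .., fun j hj => ?_⟩
    rw [Function.update_of_ne hj.ne]
    rcases Nat.lt_succ_iff_lt_or_eq.1 hj with hlt | rfl
    · rw [Function.update_of_ne (by omega)]
      exact hstep j hlt
    · rw [Function.update_self, hg]
      exact ⟨hl, hy⟩

/-- The Erdős–Szekeres theorem for sequences without a decreasing triple. -/
theorem exists_climbsTo_or_decreasing {y : ℕ → ℝ} (hy : Function.Injective y) (k : ℕ) :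
    (∃ i < 2 * k + 1, ClimbsTo y k i) ∨
      ∃ a b c, a < b ∧ b < c ∧ c < 2 * k + 1 ∧ y b < y a ∧ y c < y b := by
  classical
  by_contra! H
  obtain ⟨hclimb, hdec⟩ := H
  let r : ℕ → ℕ := fun i => Nat.findGreatest (fun l => ClimbsTo y l i) k
  have hr : ∀ i, ClimbsTo y (r i) i := fun i =>
    Nat.findGreatest_spec (P := fun l => ClimbsTo y l i) (Nat.zero_le k) trivial
  have hlt : ∀ i ∈ Finset.range (2 * k + 1), r i ∈ Finset.range k := by
    intro i hi
    rw [Finset.mem_range] at hi ⊢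
    refine (Nat.findGreatest_le k).lt_of_ne fun he => hclimb i hi ?_
    have := hr i
    rwa [show r i = k from he] at this
  have hinv : ∀ i j, j < 2 * k + 1 → i < j → r i = r j → y j < y i := by
    intro i j hj hij he
    refine lt_of_le_of_ne (not_lt.1 fun hyij => ?_) fun h => hij.ne' (hy h)
    have hk := Finset.mem_range.1 (hlt j (Finset.mem_range.2 hj))
    have : r i + 1 ≤ r j := Nat.le_findGreatest (by omega) ⟨i, hij, hyij, hr i⟩
    omega
  obtain ⟨l, -, hl⟩ := Finset.exists_lt_card_fiber_of_mul_lt_card_of_maps_to hlt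
    (n := 2) (by simp; omega)
  let g := Finset.orderEmbOfCardLe _ hl
  have hg : ∀ i, g i < 2 * k + 1 ∧ r (g i) = l := fun i => by
    have := Finset.orderEmbOfCardLe_mem _ hl i
    rwa [Finset.mem_filter, Finset.mem_range] at this
  have h01 : g 0 < g 1 := g.strictMono (by decide)
  have h12 : g 1 < g 2 := g.strictMono (by decide)
  exact not_lt.2 (hdec _ _ _ h01 h12 (hg 2).1
    (hinv _ _ (hg 1).1 h01 ((hg 0).2.trans (hg 1).2.symm)))
    (hinv _ _ (hg 2).1 h12 ((hg 1).2.trans (hg 2).2.symm))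

/-- The point played in turn `n`. -/
def turn (sA : AStrat) (sB : BStrat) (n : ℕ) : Pt :=
  (sA (hist sA sB n), sB (hist sA sB n) (sA (hist sA sB n)))

theorem mem_hist {sA : AStrat} {sB : BStrat} {n : ℕ} {p : Pt} :
    p ∈ hist sA sB n ↔ ∃ i < n, turn sA sB i = p := by
  induction n with
  | zero => simp [hist]
  | succ n ih =>
    rw [hist, List.mem_append, List.mem_singleton, ih, Nat.exists_lt_succ_right]
    exact or_congr_right eq_comm

/-- Player A can always play to the right of all points in the unit square. -/
theorem exists_rightward_strategy :
    ∃ sA : AStrat, AValid sA ∧ ∀ h, ∀ p ∈ h, p.1 < 1 → p.1 < sA h := by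
  have key : ∀ h : List Pt, ∃ x, (x ∈ Ioo (0 : ℝ) 1 ∧ ∀ p ∈ h, x ≠ p.1) ∧
      ∀ p ∈ h, p.1 < 1 → p.1 < x := by
    intro h
    obtain ⟨x, hx, hxh⟩ := exists_level (h.map Prod.swap).toFinset (fun b : ℝ => b < 1)
      (fun b => 1 ≤ b) (fun s t hs ht => hs.trans_le ht) zero_lt_one le_rfl
    have hxh' : ∀ p ∈ h, (p.1 < 1 → p.1 < x) ∧ (1 ≤ p.1 → x < p.1) := fun p hp =>
      hxh p.swap (List.mem_toFinset.2 (List.mem_map_of_mem hp))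
    refine ⟨x, ⟨hx, fun p hp => ?_⟩, fun p hp => (hxh' p hp).1⟩
    rcases lt_or_ge p.1 1 with hlt | hge
    exacts [((hxh' p hp).1 hlt).ne', ((hxh' p hp).2 hge).ne]
  choose sA hA hright using key
  exact ⟨sA, hA, hright⟩

theorem exists_aWinsBy (k : ℕ) : ∃ N sA, AWinsBy (k + 1) 3 N sA := by
  obtain ⟨sA, hA, hright⟩ := exists_rightward_strategy
  refine ⟨2 * k + 1, sA, hA, fun sB hB => ?_⟩
  have hturn : ∀ {i j}, i < j → turn sA sB i ∈ hist sA sB j := fun hij => mem_hist.2 ⟨_, hij, rfl⟩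
  have hx : ∀ {i j}, i < j → (turn sA sB i).1 < (turn sA sB j).1 := fun hij =>
    hright _ _ (hturn hij) (hA _).1.2
  have hy : Function.Injective fun i => (turn sA sB i).2 := by
    intro i j hij
    by_contra hne
    rcases lt_or_gt_of_ne hne with hlt | hlt
    exacts [(hB _ _).2 _ (hturn hlt) hij.symm, (hB _ _).2 _ (hturn hlt) hij]
  rcases exists_climbsTo_or_decreasing hy k with ⟨i, hi, hclimb⟩ | ⟨a, b, c, hab, hbc, hc, hba, hcb⟩
  · left
    obtain ⟨g, hg, hstep⟩ := hclimb.exists_index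
    have hmono : StrictMono fun j : Fin (k + 1) => g j :=
      Fin.strictMono_iff_lt_succ.2 fun j => (hstep j j.2).1
    refine ⟨fun j => turn sA sB (g j), fun j => hturn ?_, fun _ _ hij => hx (hmono hij),
      Fin.monotone_iff_le_succ.2 fun j => (hstep j j.2).2.le⟩
    have : g j ≤ g (Fin.last k) := hmono.monotone (Fin.le_last j)
    rw [Fin.val_last, hg] at this
    omega
  · right
    refine ⟨![turn sA sB a, turn sA sB b, turn sA sB c], ?_, ?_, ?_⟩
    · intro i
      fin_cases i
      exacts [hturn (hab.trans (hbc.trans hc)), hturn (hbc.trans hc), hturn hc]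
    · refine Fin.strictMono_iff_lt_succ.2 fun i => ?_
      fin_cases i
      exacts [hx hab, hx hbc]
    · refine Fin.strictAnti_iff_succ_lt.2 fun i => ?_
      fin_cases i
      exacts [hba, hcb]

theorem add_le_ESO {m d : ℕ} (hm : (d + 2).choose 3 < m) : m + d ≤ ESO m 3 := by
  have hne : {N | ∃ sA : AStrat, AWinsBy m 3 N sA}.Nonempty := by
    obtain ⟨N, hN⟩ := exists_aWinsBy (m - 1)
    rw [Nat.sub_add_cancel (by omega)] at hN
    exact ⟨N, hN⟩
  obtain ⟨sA, hsA⟩ := Nat.sInf_mem hne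
  exact hsA.add_le hm

theorem ESO_m3_lower (m : ℕ) (hm : 3 ≤ m) :
    (ESO m 3 : ℝ) > m + (6 * (m : ℝ)) ^ ((1 : ℝ) / 3) - 2 := by
  set c : ℝ := (6 * (m : ℝ)) ^ ((1 : ℝ) / 3) with hc
  have hm' : (3 : ℝ) ≤ m := by exact_mod_cast hm
  have hc3 : c ^ 3 = 6 * m := by
    rw [hc, ← Real.rpow_natCast, ← Real.rpow_mul (by positivity)]
    norm_num
  have hc1 : 1 ≤ c := Real.one_le_rpow (by linarith) (by norm_num)
  obtain ⟨d, hd⟩ := Nat.exists_eq_add_of_le' ((Nat.one_le_floor_iff c).2 hc1)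
  have hdc : ((d + 1 : ℕ) : ℝ) ≤ c := hd ▸ Nat.floor_le (by linarith)
  have hcd : c < ((d + 1 : ℕ) : ℝ) + 1 := hd ▸ Nat.lt_floor_add_one c
  have hcube : (d + 1) ^ 3 ≤ 6 * m := by
    have : ((d + 1 : ℕ) : ℝ) ^ 3 ≤ 6 * m := hc3 ▸ pow_le_pow_left₀ (by positivity) hdc 3
    exact_mod_cast this
  have hchoose : 6 * (d + 2).choose 3 = (d + 2) * (d + 1) * d := by
    have := Nat.descFactorial_eq_factorial_mul_choose (d + 2) 3
    simp [Nat.descFactorial, Nat.factorial] at this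
    rw [← this]
    ring
  have hlt : (d + 2).choose 3 < m := by nlinarith
  have hle : ((m + d : ℕ) : ℝ) ≤ ESO m 3 := by exact_mod_cast add_le_ESO hlt
  push_cast at hle hcd
  linarith
end
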